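/- arXiv:2512.02257 — 8 statements merged into one kernel-verified Lean document; each statement's English description precedes it below -/
import Mathlib

section
/- Let (W, S) be a Coxeter system and let X and Y be disjoint subsets of the set S of simple generators such that every generator in X commutes with every generator in Y (i.e., the Coxeter matrix entry M(x,y) = 2 for all x ∈ X, y ∈ Y). Then for every x in the standard parabolic subgroup W_X generated by X and every y in the standard parabolic subgroup W_Y generated by Y, the Coxeter length satisfies ℓ(x·y) = ℓ(x) + ℓ(y). -/
namespace CoxeterSystem

variable {B W : Type*} [Group W] {M : CoxeterMatrix B} (cs : CoxeterSystem M W)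

section GeometricRepresentation

open Module Polynomial.Chebyshev

theorem reflection_mul_reflection_pow_eq_one {V : Type*} [AddCommGroup V] [Module ℝ V]
    {x y : V} {f g : Dual ℝ V} (hf : f x = 2) (hg : g y = 2) {m : ℕ} (hm : 2 ≤ m)
    (hfy : f y = -2 * Real.cos (Real.pi / m)) (hgx : g x = -2 * Real.cos (Real.pi / m)) :
    (reflection hf * reflection hg) ^ m = 1 := by
  ext z
  obtain rfl | hm := hm.eq_or_lt
  · have hfy : f y = 0 := by simp [hfy]
    have hgx : g x = 0 := by simp [hgx]
    simp only [pow_two, LinearEquiv.mul_apply, reflection_apply, map_sub, map_smul, hf, hg, hfy,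
      hgx, LinearEquiv.coe_one, id_eq]
    module
  have hmpos : (0 : ℝ) < m := by positivity
  set θ : ℝ := 2 * (Real.pi / m) with hθ
  have hmθ : m * θ = 2 * Real.pi := by rw [hθ]; field_simp
  have hsin : Real.sin θ ≠ 0 := by
    refine (Real.sin_pos_of_pos_of_lt_pi (by positivity) ?_).ne'
    have : (3 : ℝ) ≤ m := by exact_mod_cast hm
    nlinarith [Real.pi_pos]
  have ht : 2 * Real.cos θ = f y * g x - 2 := by
    rw [hfy, hgx, hθ, Real.cos_two_mul]; ring
  rw [reflection_mul_reflection_pow_apply hf hg m z _ ht]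
  obtain ⟨k, rfl | rfl⟩ := m.even_or_odd'
  · have hS : (S ℝ ((k : ℤ) - 1)).eval (2 * Real.cos θ) = 0 := by
      refine (mul_eq_zero.1 ?_).resolve_right hsin
      rw [S_two_mul_real_cos, ← Real.sin_pi]
      congr 1
      push_cast at hmθ ⊢
      linarith
    have h₁ : (((2 * k : ℕ) : ℤ) - 2) / 2 = k - 1 := by lia
    have h₂ : (((2 * k : ℕ) : ℤ) - 1) / 2 = k - 1 := by lia
    rw [h₁, h₂, hS]
    simp
  · have hS : (S ℝ (k : ℤ)).eval (2 * Real.cos θ) +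
        (S ℝ ((k : ℤ) - 1)).eval (2 * Real.cos θ) = 0 := by
      refine (mul_eq_zero.1 ?_).resolve_right hsin
      rw [add_mul, S_two_mul_real_cos, S_two_mul_real_cos]
      have : (((k : ℤ) : ℝ) + 1) * θ = 2 * Real.pi - k * θ := by
        push_cast at hmθ ⊢
        linarith
      rw [this, Real.sin_two_pi_sub]
      simp
    have h₁ : (((2 * k + 1 : ℕ) : ℤ) - 2) / 2 = k - 1 := by lia
    have h₂ : (((2 * k + 1 : ℕ) : ℤ) - 1) / 2 = k := by lia
    have h₃ : (((2 * k + 1 : ℕ) : ℤ) - 3) / 2 = k - 1 := by lia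
    have h₄ : ((2 * k + 1 : ℕ) : ℤ) / 2 = k := by lia
    simp only [h₁, h₂, h₃, h₄, hS]
    simp

variable (M) in
/-- The simple coroot `αᵢ^∨` of the standard geometric representation, as a linear form. -/
noncomputable def simpleCoroot (i : B) : Dual ℝ (B →₀ ℝ) :=
  Finsupp.linearCombination ℝ fun j ↦ -2 * Real.cos (Real.pi / M i j)

theorem simpleCoroot_single (i j : B) :
    simpleCoroot M i (Finsupp.single j 1) = -2 * Real.cos (Real.pi / M i j) := by
  simp [simpleCoroot]

theorem simpleCoroot_single_self (i : B) :
    simpleCoroot M i (Finsupp.single i 1) = 2 := by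
  simp [simpleCoroot_single]

variable (M) in
/-- The reflection by which a simple generator acts in the standard geometric representation. -/
noncomputable def simpleReflection (i : B) : (B →₀ ℝ) ≃ₗ[ℝ] (B →₀ ℝ) :=
  reflection (simpleCoroot_single_self (M := M) i)

theorem isLiftable_simpleReflection : M.IsLiftable (simpleReflection M) := by
  intro i j
  obtain rfl | hij := eq_or_ne i j
  · rw [M.diagonal, pow_one, mul_eq_one_iff_eq_inv, simpleReflection, reflection_inv]
  · obtain h0 | h0 := Nat.eq_zero_or_pos (M i j)
    · rw [h0, pow_zero]
    · have h1 := M.off_diagonal i j hij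
      exact reflection_mul_reflection_pow_eq_one _ _ (by lia) (simpleCoroot_single i j)
        (by rw [simpleCoroot_single, M.symmetric j i])

theorem simple_injective : Function.Injective cs.simple := by
  intro i j h
  by_contra hij
  have h' := congr_arg (cs.lift ⟨_, isLiftable_simpleReflection⟩) h
  rw [lift_apply_simple, lift_apply_simple] at h'
  have h'' := DFunLike.congr_fun (LinearEquiv.congr_fun h' (Finsupp.single i 1)) i
  simp only [simpleReflection, reflection_apply, simpleCoroot_single_self] at h''
  simp [Ne.symm hij] at h''

end GeometricRepresentation

section InversionParity

open Classical in
/-- The action of a simple reflection on pairs of a group element and a sign: conjugation on the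
first coordinate, with a sign change exactly at the simple reflection itself. -/
noncomputable def signedConj (i : B) : Function.End (W × ZMod 2) :=
  fun p ↦ (cs.simple i * p.1 * cs.simple i, p.2 + if p.1 = cs.simple i then 1 else 0)

open Classical in
theorem signedConj_mul_pow_apply (i j : B) (m : ℕ) (p : W × ZMod 2) :
    ((cs.signedConj i * cs.signedConj j) ^ m) p =
      ((cs.simple i * cs.simple j) ^ m * p.1 * ((cs.simple i * cs.simple j) ^ m)⁻¹,
        p.2 + ∑ n ∈ Finset.range (2 * m),
          if (cs.simple i * cs.simple j) ^ n * p.1 = cs.simple j then 1 else 0) := by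
  set r := cs.simple i * cs.simple j with hr
  have hrinv : cs.simple j * r = r⁻¹ * cs.simple j := by simp [hr, mul_assoc]
  have hconj (n : ℕ) : cs.simple j * r ^ n = (r ^ n)⁻¹ * cs.simple j := by
    induction n with
    | zero => simp
    | succ n ih => rw [pow_succ, ← mul_assoc, ih, mul_assoc, hrinv, ← mul_assoc, ← mul_inv_rev,
        ← pow_succ']; simp [pow_succ]
  induction m with
  | zero => simp [Function.End.one_def]
  | succ m ih =>
    have h₁ : r ^ m * p.1 * (r ^ m)⁻¹ = cs.simple j ↔ r ^ (2 * m) * p.1 = cs.simple j := by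
      rw [mul_inv_eq_iff_eq_mul, hconj, eq_inv_mul_iff_mul_eq, ← mul_assoc, ← pow_add, two_mul]
    have h₂ : cs.simple j * (r ^ m * p.1 * (r ^ m)⁻¹) * cs.simple j = cs.simple i ↔
        r ^ (2 * m + 1) * p.1 = cs.simple j := by
      have hi : cs.simple i = r * cs.simple j := by simp [hr]
      have hj (a : W) : cs.simple j * a = r ↔ a = cs.simple j * r := by
        rw [← mul_right_inj (cs.simple j), simple_mul_simple_cancel_left]
      rw [hi, mul_left_inj, hj, hrinv, eq_inv_mul_iff_mul_eq, ← mul_assoc, ← mul_assoc,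
        mul_inv_eq_iff_eq_mul, hconj, eq_inv_mul_iff_mul_eq, ← mul_assoc, ← pow_succ', ← pow_add]
      ring_nf
    rw [pow_succ']
    change (cs.signedConj i * cs.signedConj j) (((cs.signedConj i * cs.signedConj j) ^ m) p) = _
    rw [ih]
    change cs.signedConj i (cs.signedConj j _) = _
    simp only [signedConj, h₁, h₂]
    ext
    · simp [hr, pow_succ', mul_assoc]
    · simp only [Nat.mul_succ, Finset.sum_range_succ, add_assoc]

theorem isLiftable_signedConj : M.IsLiftable cs.signedConj := by
  classical
  intro i j
  funext p
  rw [signedConj_mul_pow_apply, two_mul, Finset.sum_range_add]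
  simp only [pow_add, simple_mul_simple_pow, one_mul, CharTwo.add_self_eq_zero]
  simp
  rfl

open Classical in
theorem lift_signedConj_wordProd (ω : List B) (p : W × ZMod 2) :
    cs.lift ⟨_, cs.isLiftable_signedConj⟩ (cs.wordProd ω) p =
      (cs.wordProd ω * p.1 * (cs.wordProd ω)⁻¹, p.2 + ((cs.rightInvSeq ω).count p.1 : ZMod 2)) := by
  induction ω with
  | nil => simp [Function.End.one_def]
  | cons i ω ih =>
    rw [wordProd_cons, map_mul, lift_apply_simple]
    change cs.signedConj i (cs.lift ⟨_, cs.isLiftable_signedConj⟩ (cs.wordProd ω) p) = _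
    rw [ih]
    have h : cs.wordProd ω * p.1 * (cs.wordProd ω)⁻¹ = cs.simple i ↔
        (cs.wordProd ω)⁻¹ * cs.simple i * cs.wordProd ω = p.1 := by
      rw [mul_inv_eq_iff_eq_mul, mul_assoc, inv_mul_eq_iff_eq_mul, eq_comm]
    simp only [signedConj, rightInvSeq, List.count_cons, h, beq_iff_eq]
    ext
    · simp [mul_assoc]
    · simp [add_assoc]

open Classical in
/-- The parity of the number of occurrences of `t` in the right inversion sequence of a word
depends only on the product of the word. -/
theorem count_rightInvSeq_mod_two {ω ω' : List B} (h : cs.wordProd ω = cs.wordProd ω') (t : W) :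
    (cs.rightInvSeq ω).count t % 2 = (cs.rightInvSeq ω').count t % 2 := by
  have := congr_arg (fun w ↦ (cs.lift ⟨_, cs.isLiftable_signedConj⟩ w (t, 0)).2) h
  simp only [lift_signedConj_wordProd, zero_add] at this
  exact (ZMod.natCast_eq_natCast_iff' _ _ _).1 this

/-- If the right inversion sequence of `ω` has no repetitions, it is contained in the right
inversion sequence of every word with the same product. -/
theorem rightInvSeq_subset_of_nodup {ω ω' : List B} (hω : (cs.rightInvSeq ω).Nodup)
    (h : cs.wordProd ω = cs.wordProd ω') : cs.rightInvSeq ω ⊆ cs.rightInvSeq ω' := by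
  classical
  intro t ht
  have := cs.count_rightInvSeq_mod_two h t
  rw [List.count_eq_one_of_mem hω ht] at this
  exact List.count_pos_iff.1 (by lia)

/-- A word whose right inversion sequence has no repetitions is reduced. -/
theorem isReduced_of_nodup_rightInvSeq {ω : List B} (hω : (cs.rightInvSeq ω).Nodup) :
    cs.IsReduced ω := by
  obtain ⟨ω', hω', h⟩ := cs.exists_isReduced (cs.wordProd ω)
  have := (hω.subperm (cs.rightInvSeq_subset_of_nodup hω h)).length_le
  rw [length_rightInvSeq, length_rightInvSeq, ← hω'.eq, ← h] at this
  exact (cs.length_wordProd_le ω).antisymm this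

end InversionParity

theorem rightInvSeq_append (ω ω' : List B) :
    cs.rightInvSeq (ω ++ ω') =
      (cs.rightInvSeq ω).map (fun t ↦ (cs.wordProd ω')⁻¹ * t * cs.wordProd ω') ++
        cs.rightInvSeq ω' := by
  induction ω with
  | nil => simp
  | cons i ω ih => simp [rightInvSeq, ih, wordProd_append, mul_assoc]

theorem exists_wordProd_of_mem_closure {X : Set B} {w : W}
    (hw : w ∈ Subgroup.closure (cs.simple '' X)) :
    ∃ ω : List B, (∀ i ∈ ω, i ∈ X) ∧ cs.wordProd ω = w := by
  induction hw using Subgroup.closure_induction with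
  | mem _ h =>
    obtain ⟨i, hi, rfl⟩ := h
    exact ⟨[i], by simpa using hi, by simp⟩
  | one => exact ⟨[], by simp, by simp⟩
  | mul _ _ _ _ h h' =>
    obtain ⟨ω, hω, rfl⟩ := h
    obtain ⟨ω', hω', rfl⟩ := h'
    exact ⟨ω ++ ω', by simpa [or_imp, forall_and] using ⟨hω, hω'⟩, cs.wordProd_append ω ω'⟩
  | inv _ _ h =>
    obtain ⟨ω, hω, rfl⟩ := h
    exact ⟨ω.reverse, by simpa using hω, cs.wordProd_reverse ω⟩

theorem wordProd_mem_closure {X : Set B} {ω : List B} (hω : ∀ i ∈ ω, i ∈ X) :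
    cs.wordProd ω ∈ Subgroup.closure (cs.simple '' X) :=
  Subgroup.list_prod_mem _ fun w hw ↦ by
    obtain ⟨i, hi, rfl⟩ := List.mem_map.1 hw
    exact Subgroup.subset_closure ⟨i, hω i hi, rfl⟩

theorem exists_conj_of_mem_rightInvSeq {X : Set B} {ω : List B} (hω : ∀ i ∈ ω, i ∈ X) {t : W}
    (ht : t ∈ cs.rightInvSeq ω) :
    ∃ i ∈ X, ∃ u ∈ Subgroup.closure (cs.simple '' X), t = u⁻¹ * cs.simple i * u := by
  induction ω with
  | nil => simp at ht
  | cons i ω ih =>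
    rw [List.forall_mem_cons] at hω
    rw [rightInvSeq, List.mem_cons] at ht
    obtain rfl | ht := ht
    · exact ⟨i, hω.1, _, cs.wordProd_mem_closure hω.2, rfl⟩
    · exact ih hω.2 ht

/-- The right inversions of an element of a standard parabolic subgroup are conjugates of its
simple generators inside that subgroup. -/
theorem IsReduced.exists_conj_of_mem_rightInvSeq {cs : CoxeterSystem M W} {X : Set B} {ω : List B}
    (hω : cs.IsReduced ω) (hX : cs.wordProd ω ∈ Subgroup.closure (cs.simple '' X)) {t : W}
    (ht : t ∈ cs.rightInvSeq ω) :
    ∃ i ∈ X, ∃ u ∈ Subgroup.closure (cs.simple '' X), t = u⁻¹ * cs.simple i * u := by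
  obtain ⟨ω', hω', h⟩ := cs.exists_wordProd_of_mem_closure hX
  exact cs.exists_conj_of_mem_rightInvSeq hω'
    (cs.rightInvSeq_subset_of_nodup hω.nodup_rightInvSeq h.symm ht)

theorem commute_simple_of_eq_two {i j : B} (h : M i j = 2) :
    Commute (cs.simple i) (cs.simple j) := by
  have := cs.simple_mul_simple_pow i j
  rw [h, pow_two, mul_eq_one_iff_eq_inv] at this
  simpa [Commute, SemiconjBy] using this

theorem commute_of_mem_closure {X Y : Set B} (h : ∀ i ∈ X, ∀ j ∈ Y, M i j = 2) {x y : W}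
    (hx : x ∈ Subgroup.closure (cs.simple '' X)) (hy : y ∈ Subgroup.closure (cs.simple '' Y)) :
    Commute x y := by
  have hle : Subgroup.closure (cs.simple '' X) ≤
      Subgroup.centralizer (Subgroup.closure (cs.simple '' Y)) := by
    rw [Subgroup.centralizer_closure, Subgroup.closure_le]
    rintro _ ⟨i, hi, rfl⟩
    rw [SetLike.mem_coe, Subgroup.mem_centralizer_iff]
    rintro _ ⟨j, hj, rfl⟩
    exact (cs.commute_simple_of_eq_two (h i hi j hj)).symm
  exact (Subgroup.mem_centralizer_iff.1 (hle hx) y hy).symm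

end CoxeterSystem

/-- Let `(W, S)` be a Coxeter system and `X`, `Y` disjoint subsets of the
simple generators such that every generator in `X` commutes with every generator in `Y`
(Coxeter matrix entry `M x y = 2`). Then for every `x` in the standard parabolic subgroup
`W_X` and `y` in `W_Y`, the Coxeter length satisfies `ℓ(x * y) = ℓ x + ℓ y`. -/
theorem length_mul_of_commuting_parabolics
    {B : Type*} {W : Type*} [Group W] {M : CoxeterMatrix B}
    (cs : CoxeterSystem M W) (X Y : Set B) (hdisj : Disjoint X Y)
    (hcomm : ∀ x ∈ X, ∀ y ∈ Y, M x y = 2) :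
    ∀ x ∈ Subgroup.closure (cs.simple '' X), ∀ y ∈ Subgroup.closure (cs.simple '' Y),
      cs.length (x * y) = cs.length x + cs.length y := by
  intro x hx y hy
  obtain ⟨ω, hω, rfl⟩ := cs.exists_isReduced x
  obtain ⟨ω', hω', rfl⟩ := cs.exists_isReduced y
  have hcommute {u v : W} := cs.commute_of_mem_closure hcomm (x := u) (y := v)
  have hsimple {Z : Set B} {i : B} (hi : i ∈ Z) :
      cs.simple i ∈ Subgroup.closure (cs.simple '' Z) := Subgroup.subset_closure ⟨i, hi, rfl⟩
  have hmem {t : W} (ht : t ∈ cs.rightInvSeq ω) : t ∈ Subgroup.closure (cs.simple '' X) := by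
    obtain ⟨i, hi, u, hu, rfl⟩ := hω.exists_conj_of_mem_rightInvSeq hx ht
    exact mul_mem (mul_mem (inv_mem hu) (hsimple hi)) hu
  have happend : cs.rightInvSeq (ω ++ ω') = cs.rightInvSeq ω ++ cs.rightInvSeq ω' := by
    rw [cs.rightInvSeq_append]
    congr 1
    refine (List.map_congr_left fun t ht ↦ ?_).trans (List.map_id _)
    have htw : t * cs.wordProd ω' = cs.wordProd ω' * t := hcommute (hmem ht) hy
    rw [mul_assoc, htw, inv_mul_cancel_left, id]
  have hnodup : (cs.rightInvSeq (ω ++ ω')).Nodup := by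
    rw [happend]
    refine hω.nodup_rightInvSeq.append hω'.nodup_rightInvSeq fun t ht ht' ↦ ?_
    obtain ⟨i, hi, u, hu, hut⟩ := hω.exists_conj_of_mem_rightInvSeq hx ht
    obtain ⟨j, hj, v, hv, hvt⟩ := hω'.exists_conj_of_mem_rightInvSeq hy ht'
    have hj' : t = cs.simple j := by
      have htv : t * v = v * t := hcommute (hmem ht) hv
      have : v * t = cs.simple j * v := by rw [hvt]; group
      exact mul_right_cancel (htv.trans this)
    have hi' : t = cs.simple i := by
      have htu : u * t = t * u := hcommute hu (hj' ▸ hsimple hj)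
      have : u * t = cs.simple i * u := by rw [hut]; group
      exact mul_right_cancel (htu.symm.trans this)
    exact hdisj.le_bot ⟨hi, cs.simple_injective (hi'.symm.trans hj') ▸ hj⟩
  rw [← cs.wordProd_append, (cs.isReduced_of_nodup_rightInvSeq hnodup).eq, List.length_append,
    hω.eq, hω'.eq]
end

section
/- Let P = (p₁, …, p_k) be a probability vector with rational entries and all p_i > 0, and let N_P be the set of positive integers n such that n·p_i is an integer greater than 3 for every i = 1, …, k. Then the limit, as n → ∞ with n ranging over N_P, of (1/n) · ln( (2^{n-1} · (n-1)!) / ( (n p₁)! · (n p₂)! ⋯ (n p_{k-1})! · 2^{n p_k - 1} · (n p_k - 1)! ) ) equals H(P) + (1 - p_k)·ln 2, where H(P) = -Σ_{i=1}^k p_i ln p_i. (This quotient is the index of the parabolic subgroup associated with P in a finite reflection group of type B_{n-1} or C_{n-1}, whose cardinality is 2^{n-1}(n-1)!.) -/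
open Filter Real

/-- The error term in the crude Stirling approximation `log n! ≈ n log n - n`. -/
noncomputable def logFactorialError (n : ℕ) : ℝ :=
  Real.log (n.factorial : ℝ) - n * Real.log n + n

theorem tendsto_logFactorialError_div :
    Tendsto (fun n : ℕ => logFactorialError n / n) atTop (nhds 0) := by
  have hlog : Tendsto (fun n : ℕ => Real.log n / n) atTop (nhds 0) :=
    (Real.isLittleO_log_id_atTop.tendsto_div_nhds_zero).comp tendsto_natCast_atTop_atTop
  have hst : Tendsto (fun n : ℕ => Real.log (Stirling.stirlingSeq n)) atTop
      (nhds (Real.log (√π))) :=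
    Stirling.tendsto_stirlingSeq_sqrt_pi.log (by positivity)
  have h := ((hst.add_const (1 / 2 * Real.log 2)).div_atTop
    (tendsto_natCast_atTop_atTop (R := ℝ))).add (hlog.const_mul (1 / 2))
  simp only [mul_zero, add_zero] at h
  refine h.congr' ?_
  filter_upwards [eventually_gt_atTop 0] with n hn
  have hn' : (n : ℝ) ≠ 0 := by positivity
  rw [Stirling.log_stirlingSeq_formula, Real.log_mul two_ne_zero hn',
    Real.log_div hn' (Real.exp_ne_zero _), Real.log_exp, logFactorialError]
  field_simp
  ring

theorem tendsto_logFactorialError_floor_mul_div {q : ℚ} (hq : 0 < q) :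
    Tendsto (fun n : ℕ => logFactorialError ⌊(n : ℚ) * q⌋₊ / n)
      (atTop ⊓ 𝓟 {n : ℕ | ∃ m : ℕ, 0 < m ∧ (m : ℚ) = (n : ℚ) * q}) (nhds 0) := by
  have hfloor : Tendsto (fun n : ℕ => ⌊(n : ℚ) * q⌋₊) atTop atTop :=
    tendsto_nat_floor_atTop.comp (tendsto_natCast_atTop_atTop.atTop_mul_const hq)
  have h := ((tendsto_logFactorialError_div.comp hfloor).mul_const (q : ℝ)).mono_left
    (inf_le_left (b := 𝓟 {n : ℕ | ∃ m : ℕ, 0 < m ∧ (m : ℚ) = (n : ℚ) * q}))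
  rw [zero_mul] at h
  refine h.congr' ?_
  filter_upwards [mem_inf_of_right (mem_principal_self _)] with n ⟨m, hm, hmn⟩
  have hmn' : (m : ℝ) = n * q := by exact_mod_cast hmn
  have hm' : (m : ℝ) ≠ 0 := by positivity
  have hn : (n : ℝ) ≠ 0 := by
    rintro h0
    exact hm' (by rw [hmn', h0, zero_mul])
  have hq' : (q : ℝ) ≠ 0 := by positivity
  simp only [Function.comp_apply, ← hmn, Nat.floor_natCast]
  rw [hmn']
  field_simp

theorem log_factorial_eq (n : ℕ) :
    Real.log (n.factorial : ℝ) = n * Real.log n - n + logFactorialError n := by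
  rw [logFactorialError]
  ring

theorem log_factorial_pred {n : ℕ} (hn : 0 < n) :
    Real.log ((n - 1).factorial : ℝ) = Real.log (n.factorial : ℝ) - Real.log n := by
  rw [← Nat.mul_factorial_pred hn.ne', Nat.cast_mul,
    Real.log_mul (by positivity) (by positivity)]
  ring

/-- The logarithm of the index of a parabolic subgroup in the type `B` reflection group. -/
theorem log_index_type_B {k n : ℕ} (hn : 0 < n) (p : Fin (k + 1) → ℝ) (m : Fin (k + 1) → ℕ)
    (hm : ∀ i, 0 < m i) (hmp : ∀ i, (m i : ℝ) = n * p i) (hp : ∑ i, p i = 1) :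
    Real.log (((2 : ℝ) ^ (n - 1) * (Nat.factorial (n - 1) : ℝ)) /
        ((∏ i : Fin k, (Nat.factorial (m i.castSucc) : ℝ)) *
          (2 : ℝ) ^ (m (Fin.last k) - 1) * (Nat.factorial (m (Fin.last k) - 1) : ℝ))) =
      n * ((-∑ i, p i * Real.log (p i)) + (1 - p (Fin.last k)) * Real.log 2) +
        logFactorialError n - ∑ i, logFactorialError (m i) + Real.log (p (Fin.last k)) := by
  have hn' : (n : ℝ) ≠ 0 := by positivity
  have hp0 : ∀ i, p i ≠ 0 := fun i h0 => by
    have := hmp i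
    rw [h0, mul_zero] at this
    exact (hm i).ne' (by exact_mod_cast this)
  have hprod : (∏ i : Fin k, (Nat.factorial (m i.castSucc) : ℝ)) ≠ 0 :=
    Finset.prod_ne_zero_iff.2 fun i _ => by positivity
  have hlog : ∀ i, Real.log (m i) = Real.log n + Real.log (p i) := fun i => by
    rw [hmp, Real.log_mul hn' (hp0 i)]
  have hsum : ∑ i, Real.log ((m i).factorial : ℝ) =
      n * Real.log n - n + n * ∑ i, p i * Real.log (p i) + ∑ i, logFactorialError (m i) := by
    have h1 : ∀ i, Real.log ((m i).factorial : ℝ) =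
        p i * (n * Real.log n - n) + n * (p i * Real.log (p i)) + logFactorialError (m i) :=
      fun i => by rw [log_factorial_eq, hlog, hmp]; ring
    simp only [h1, Finset.sum_add_distrib, ← Finset.sum_mul, ← Finset.mul_sum, hp, one_mul]
  rw [Fin.sum_univ_castSucc] at hsum
  rw [Real.log_div (by positivity) (by positivity), Real.log_mul (by positivity) (by positivity),
    Real.log_mul (by positivity) (by positivity), Real.log_mul hprod (by positivity),
    Real.log_prod (fun i _ => by positivity), Real.log_pow, Real.log_pow,
    log_factorial_pred hn, log_factorial_pred (hm _), Nat.cast_pred hn, Nat.cast_pred (hm _),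
    hlog, hmp, log_factorial_eq n]
  linear_combination -hsum

/-- For a rational probability vector `P = (p₁, …, p_{k+1})` with positive
entries, along the set `N_P` of positive integers `n` with each `n·pᵢ` an integer `> 3`, the
quantity `(1/n)·ln( 2^{n-1}(n-1)! / ((np₁)!⋯(np_k)!·2^{np_{k+1}-1}(np_{k+1}-1)!) )` tends to
`H(P) + (1 - p_{k+1})·ln 2` (reflective entropy); this quotient is the index of the parabolic
subgroup associated with `P` in a reflection group of type `B_{n-1}` or `C_{n-1}`. -/
theorem reflective_entropy_limit_type_B
    (k : ℕ) (p : Fin (k + 1) → ℚ) (hp0 : ∀ i, 0 < p i) (hp1 : ∑ i, p i = 1) :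
    Tendsto
      (fun n : ℕ =>
        (1 / (n : ℝ)) * Real.log
          (((2 : ℝ) ^ (n - 1) * (Nat.factorial (n - 1) : ℝ)) /
            ((∏ i : Fin k, (Nat.factorial ⌊(n : ℚ) * p i.castSucc⌋₊ : ℝ)) *
              (2 : ℝ) ^ (⌊(n : ℚ) * p (Fin.last k)⌋₊ - 1) *
              (Nat.factorial (⌊(n : ℚ) * p (Fin.last k)⌋₊ - 1) : ℝ))))
      (atTop ⊓ 𝓟 {n : ℕ | 0 < n ∧ ∀ i, ∃ m : ℕ, 3 < m ∧ (m : ℚ) = (n : ℚ) * p i})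
      (nhds ((-∑ i, (p i : ℝ) * Real.log (p i : ℝ)) +
        (1 - (p (Fin.last k) : ℝ)) * Real.log 2)) := by
  set S := {n : ℕ | 0 < n ∧ ∀ i, ∃ m : ℕ, 3 < m ∧ (m : ℚ) = (n : ℚ) * p i}
  have hR : Tendsto (fun n : ℕ => logFactorialError n / n) (atTop ⊓ 𝓟 S) (nhds 0) :=
    tendsto_logFactorialError_div.mono_left inf_le_left
  have hS : ∀ i, Tendsto (fun n : ℕ => logFactorialError ⌊(n : ℚ) * p i⌋₊ / n)
      (atTop ⊓ 𝓟 S) (nhds 0) := fun i =>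
    (tendsto_logFactorialError_floor_mul_div (hp0 i)).mono_left <|
      inf_le_inf_left _ <| principal_mono.2 fun n hn => by
        obtain ⟨m, hm, hmn⟩ := hn.2 i
        exact ⟨m, by omega, hmn⟩
  have hc : Tendsto (fun n : ℕ => Real.log (p (Fin.last k)) / n) (atTop ⊓ 𝓟 S) (nhds 0) :=
    (tendsto_const_div_atTop_nhds_zero_nat _).mono_left inf_le_left
  have h := ((hR.const_add ((-∑ i, (p i : ℝ) * Real.log (p i : ℝ)) +
    (1 - (p (Fin.last k) : ℝ)) * Real.log 2)).sub
      (tendsto_finsetSum Finset.univ fun i _ => hS i)).add hc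
  simp only [Finset.sum_const_zero, add_zero, sub_zero] at h
  refine h.congr' ?_
  filter_upwards [mem_inf_of_right (mem_principal_self _)] with n ⟨hn, hnp⟩
  choose m hm hmp using hnp
  have hn' : (n : ℝ) ≠ 0 := by positivity
  simp only [← hmp, Nat.floor_natCast]
  rw [log_index_type_B hn (fun i => (p i : ℝ)) m (fun i => by have := hm i; omega)
    (fun i => by exact_mod_cast hmp i) (by exact_mod_cast hp1), ← Finset.sum_div]
  field_simp
end

section
/- Let P = (p₁, …, p_k) be a probability vector with rational entries and all p_i > 0, and let N_P be the set of positive integers n such that n·p_i is an integer greater than 3 for every i = 1, …, k. Then the limit, as n → ∞ with n ranging over N_P, of (1/n) · ln( (2^{n-2} · (n-1)!) / ( (n p₁)! · (n p₂)! ⋯ (n p_{k-1})! · 2^{n p_k - 2} · (n p_k - 1)! ) ) equals H(P) + (1 - p_k)·ln 2, where H(P) = -Σ_{i=1}^k p_i ln p_i. (This quotient is the index of the parabolic subgroup associated with P in a finite reflection group of type D_{n-1}, whose cardinality is 2^{n-2}(n-1)!.) -/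
open Filter Real

/-- The leading order of Stirling's formula: `log m! / m = log m - 1 + o(1)`. -/
lemma tendsto_log_factorial_div_sub_log :
    Tendsto (fun m : ℕ => Real.log (m.factorial : ℝ) / m - Real.log m) atTop (nhds (-1)) := by
  have hinv : Tendsto (fun m : ℕ => (m : ℝ)⁻¹) atTop (nhds 0) :=
    tendsto_inv_atTop_zero.comp tendsto_natCast_atTop_atTop
  have hlog : Tendsto (fun m : ℕ => Real.log m / m) atTop (nhds 0) := by
    have h := Real.isLittleO_log_id_atTop.tendsto_div_nhds_zero
    exact h.comp tendsto_natCast_atTop_atTop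
  have hseq : Tendsto (fun m : ℕ => Real.log (Stirling.stirlingSeq m)) atTop
      (nhds (Real.log √π)) :=
    Stirling.tendsto_stirlingSeq_sqrt_pi.log (by positivity)
  have hlim : Tendsto (fun m : ℕ => Real.log (Stirling.stirlingSeq m) * (m : ℝ)⁻¹
      + 1 / 2 * (Real.log 2 * (m : ℝ)⁻¹ + Real.log m / m) - 1) atTop (nhds (-1)) := by
    have h := ((hseq.mul hinv).add
      (((hinv.const_mul (Real.log 2)).add hlog).const_mul (1 / 2))).sub_const 1
    simpa only [mul_zero, add_zero, zero_sub] using h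
  refine hlim.congr' ?_
  filter_upwards [eventually_gt_atTop 0] with m hm
  have hm' : (m : ℝ) ≠ 0 := by positivity
  rw [Stirling.log_stirlingSeq_formula, Real.log_mul two_ne_zero hm',
    Real.log_div hm' (Real.exp_ne_zero 1), Real.log_exp]
  field_simp
  ring

/-- The logarithm of the factorial of a predecessor. -/
lemma log_factorial_pred_s3 {m : ℕ} (hm : 0 < m) :
    Real.log ((m - 1).factorial : ℝ) = Real.log (m.factorial : ℝ) - Real.log m := by
  have hm' : (m : ℝ) ≠ 0 := by positivity
  have hf : ((m - 1).factorial : ℝ) ≠ 0 := by positivity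
  rw [← Nat.mul_factorial_pred hm.ne', Nat.cast_mul, Real.log_mul hm' hf]
  ring

/-- For a rational probability vector `P = (p₁, …, p_{k+1})` with positive
entries, along the set `N_P` of positive integers `n` with each `n·pᵢ` an integer `> 3`, the
quantity `(1/n)·ln( 2^{n-2}(n-1)! / ((np₁)!⋯(np_k)!·2^{np_{k+1}-2}(np_{k+1}-1)!) )` tends to
`H(P) + (1 - p_{k+1})·ln 2` (reflective entropy); this quotient is the index of the parabolic
subgroup associated with `P` in a reflection group of type `D_{n-1}`. -/
theorem reflective_entropy_limit_type_D
    (k : ℕ) (p : Fin (k + 1) → ℚ) (hp0 : ∀ i, 0 < p i) (hp1 : ∑ i, p i = 1) :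
    Tendsto
      (fun n : ℕ =>
        (1 / (n : ℝ)) * Real.log
          (((2 : ℝ) ^ (n - 2) * (Nat.factorial (n - 1) : ℝ)) /
            ((∏ i : Fin k, (Nat.factorial ⌊(n : ℚ) * p i.castSucc⌋₊ : ℝ)) *
              (2 : ℝ) ^ (⌊(n : ℚ) * p (Fin.last k)⌋₊ - 2) *
              (Nat.factorial (⌊(n : ℚ) * p (Fin.last k)⌋₊ - 1) : ℝ))))
      (atTop ⊓ 𝓟 {n : ℕ | 0 < n ∧ ∀ i, ∃ m : ℕ, 3 < m ∧ (m : ℚ) = (n : ℚ) * p i})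
      (nhds ((-∑ i, (p i : ℝ) * Real.log (p i : ℝ)) +
        (1 - (p (Fin.last k) : ℝ)) * Real.log 2)) := by
  set r : ℕ → ℝ := fun m => Real.log (m.factorial : ℝ) / m - Real.log m with hr
  have hp0' : ∀ i, (0 : ℝ) < p i := fun i => by exact_mod_cast hp0 i
  have hp1' : ∑ i, (p i : ℝ) = 1 := by exact_mod_cast hp1
  have hfloor (i) : Tendsto (fun n : ℕ => ⌊(n : ℚ) * p i⌋₊) atTop atTop :=
    tendsto_nat_floor_atTop.comp (tendsto_natCast_atTop_atTop.atTop_mul_const (hp0 i))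
  have hinv : Tendsto (fun n : ℕ => (n : ℝ)⁻¹) atTop (nhds 0) :=
    tendsto_inv_atTop_zero.comp tendsto_natCast_atTop_atTop
  have hlim : Tendsto (fun n : ℕ => (r n - ∑ i, (p i : ℝ) * r ⌊(n : ℚ) * p i⌋₊)
      + Real.log (p (Fin.last k)) * (n : ℝ)⁻¹
      + ((-∑ i, (p i : ℝ) * Real.log (p i : ℝ)) + (1 - (p (Fin.last k) : ℝ)) * Real.log 2))
      atTop (nhds ((-∑ i, (p i : ℝ) * Real.log (p i : ℝ)) +
        (1 - (p (Fin.last k) : ℝ)) * Real.log 2)) := by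
    have hsum : Tendsto (fun n : ℕ => ∑ i, (p i : ℝ) * r ⌊(n : ℚ) * p i⌋₊) atTop
        (nhds (∑ i, (p i : ℝ) * (-1))) :=
      tendsto_finsetSum _ fun i _ =>
        (tendsto_log_factorial_div_sub_log.comp (hfloor i)).const_mul _
    rw [← Finset.sum_mul, hp1'] at hsum
    simpa using ((tendsto_log_factorial_div_sub_log.sub hsum).add
      (hinv.const_mul (Real.log (p (Fin.last k))))).add_const
      ((-∑ i, (p i : ℝ) * Real.log (p i : ℝ)) + (1 - (p (Fin.last k) : ℝ)) * Real.log 2)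
  refine (hlim.mono_left inf_le_left).congr' ?_
  filter_upwards [mem_inf_of_right (mem_principal_self _)] with n hn
  obtain ⟨hn0, hn⟩ := hn
  choose m hm3 hm using hn
  have hfl (i) : ⌊(n : ℚ) * p i⌋₊ = m i := by rw [← hm i, Nat.floor_natCast]
  simp only [hfl]
  have hmR (i) : (m i : ℝ) = n * p i := by exact_mod_cast hm i
  have hnR : (0 : ℝ) < n := by exact_mod_cast hn0
  have hle : m (Fin.last k) ≤ n := by
    have h1 : (p (Fin.last k) : ℝ) ≤ 1 := hp1' ▸
      Finset.single_le_sum (f := fun i => (p i : ℝ)) (fun i _ => (hp0' i).le) (Finset.mem_univ _)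
    have h2 : (m (Fin.last k) : ℝ) ≤ n := by
      rw [hmR]
      exact mul_le_of_le_one_right hnR.le h1
    exact_mod_cast h2
  have hl3 := hm3 (Fin.last k)
  have hlogm (i) : Real.log (m i) = Real.log n + Real.log (p i) := by
    rw [hmR, Real.log_mul hnR.ne' (hp0' i).ne']
  have hterm (i) : (p i : ℝ) * r (m i) =
      Real.log ((m i).factorial : ℝ) / n - p i * Real.log n - p i * Real.log (p i) := by
    have := (hp0' i).ne'
    simp only [hr, hlogm]
    rw [hmR]
    field_simp
    ring
  have hsumr : ∑ i, (p i : ℝ) * r (m i) =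
      (∑ i : Fin k, Real.log ((m i.castSucc).factorial : ℝ)
        + Real.log ((m (Fin.last k)).factorial : ℝ)) / n
        - Real.log n - ∑ i, (p i : ℝ) * Real.log (p i) := by
    simp only [hterm]
    rw [Finset.sum_sub_distrib, Finset.sum_sub_distrib, ← Finset.sum_mul, hp1', one_mul,
      ← Finset.sum_div, Fin.sum_univ_castSucc (fun i => Real.log ((m i).factorial : ℝ))]
  have hfac (j : ℕ) : (j.factorial : ℝ) ≠ 0 := by positivity
  have hprod : ∏ i : Fin k, ((m i.castSucc).factorial : ℝ) ≠ 0 :=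
    Finset.prod_ne_zero_iff.mpr fun i _ => hfac _
  have htwo (j : ℕ) : (2 : ℝ) ^ j ≠ 0 := by positivity
  rw [Real.log_div (mul_ne_zero (htwo _) (hfac _))
      (mul_ne_zero (mul_ne_zero hprod (htwo _)) (hfac _)),
    Real.log_mul (htwo _) (hfac _), Real.log_mul (mul_ne_zero hprod (htwo _)) (hfac _),
    Real.log_mul hprod (htwo _), Real.log_prod fun i _ => hfac _,
    Real.log_pow, Real.log_pow, log_factorial_pred_s3 hn0, log_factorial_pred_s3 (by omega),
    Nat.cast_sub (by omega), Nat.cast_sub (by omega), hsumr, hlogm, hmR]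
  simp only [hr]
  field_simp
  ring
end

section
/- Let π : {1, …, k} → {1, …, m} be an increasing surjection, let P = (p₁, …, p_k) be a probability vector with all p_i > 0, let Q = π_*P be its push-forward with entries q_j = Σ_{i ∈ π⁻¹(j)} p_i, and for each j let P|_j be the conditional probability vector on π⁻¹(j) with entries p_i/q_j. Then the reflective entropy satisfies the chain rule H_R(P) = H_R(Q) + Σ_{j=1}^{m-1} q_j · H(P|_j) + q_m · H_R(P|_j at j = m), i.e., H_R(P) = H_R(Q) + Σ_{j=1}^{m-1} q_j H(P|_j) + q_m H_R(P|_m). -/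
open Finset

/-- The entropy of a positive weight vector on `s`, normalized by its total mass `c` and scaled
back by `c`. -/
lemma mul_sum_neg_div_mul_log_div {ι : Type*} (s : Finset ι) (p : ι → ℝ) (c : ℝ)
    (hp : ∀ i ∈ s, p i ≠ 0) (hc : c ≠ 0) (hsum : c = ∑ i ∈ s, p i) :
    c * ∑ i ∈ s, -((p i / c) * Real.log (p i / c)) =
      -∑ i ∈ s, p i * Real.log (p i) + c * Real.log c := by
  have h : ∀ i ∈ s, c * -((p i / c) * Real.log (p i / c)) =
      -(p i * Real.log (p i)) + p i * Real.log c := by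
    intro i hi
    rw [Real.log_div (hp i hi) hc]
    field_simp
    ring
  rw [mul_sum, sum_congr rfl h, sum_add_distrib, sum_neg_distrib, ← sum_mul, ← hsum]

/-- Chain rule for the reflective entropy `H_R(P) = H(P) + (1 - p_last)·ln 2`.
For an increasing surjection `π : {1,…,k+1} → {1,…,m+1}`, a positive probability vector `P`
with push-forward `Q = π_*P` (`q j = Σ_{i ∈ π⁻¹(j)} p i`) and conditional vectors `P|_j` with
entries `pᵢ/q_j`, one has
`H_R(P) = H_R(Q) + Σ_{j=1}^{m} q_j·H(P|_j) + q_{m+1}·H_R(P|_{m+1})`. -/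
theorem reflective_entropy_chain_rule
    (k m : ℕ) (π : Fin (k + 1) → Fin (m + 1)) (hmono : Monotone π)
    (hsurj : Function.Surjective π)
    (p : Fin (k + 1) → ℝ) (hp0 : ∀ i, 0 < p i) (hp1 : ∑ i, p i = 1) :
    ∀ q : Fin (m + 1) → ℝ, (∀ j, q j = ∑ i ∈ univ.filter (fun i => π i = j), p i) →
      ((-∑ i, p i * Real.log (p i)) + (1 - p (Fin.last k)) * Real.log 2) =
        (((-∑ j, q j * Real.log (q j)) + (1 - q (Fin.last m)) * Real.log 2) +
          (∑ j : Fin m, q j.castSucc *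
            (∑ i ∈ univ.filter (fun i => π i = j.castSucc),
              -((p i / q j.castSucc) * Real.log (p i / q j.castSucc)))) +
          q (Fin.last m) *
            ((∑ i ∈ univ.filter (fun i => π i = Fin.last m),
              -((p i / q (Fin.last m)) * Real.log (p i / q (Fin.last m)))) +
              (1 - p (Fin.last k) / q (Fin.last m)) * Real.log 2)) := by
  intro q hq
  have hqpos : ∀ j, 0 < q j := by
    intro j
    obtain ⟨i, hi⟩ := hsurj j
    rw [hq j]
    exact sum_pos (fun i _ => hp0 i) ⟨i, by simp [hi]⟩
  have hfiber : ∀ j, q j * ∑ i ∈ univ.filter (fun i => π i = j),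
      -((p i / q j) * Real.log (p i / q j)) =
      -∑ i ∈ univ.filter (fun i => π i = j), p i * Real.log (p i) + q j * Real.log (q j) :=
    fun j => mul_sum_neg_div_mul_log_div _ p (q j) (fun i _ => (hp0 i).ne') (hqpos j).ne' (hq j)
  have htotal : ∑ i, p i * Real.log (p i) =
      ∑ j, ∑ i ∈ univ.filter (fun i => π i = j), p i * Real.log (p i) :=
    (sum_fiberwise univ π _).symm
  have hlast : q (Fin.last m) * ((1 - p (Fin.last k) / q (Fin.last m)) * Real.log 2) =
      (q (Fin.last m) - p (Fin.last k)) * Real.log 2 := by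
    have := (hqpos (Fin.last m)).ne'
    field_simp
  rw [mul_add, hlast, hfiber, sum_congr rfl fun j _ => hfiber (Fin.castSucc j), htotal,
    Fin.sum_univ_castSucc, Fin.sum_univ_castSucc, sum_add_distrib, sum_neg_distrib]
  ring
end

section
/- Let q be a prime power, let V = 𝔽_q^{2n} carry the standard symplectic form ⟨x, y⟩ = xᵀ J y with J = [[0, -1ₙ],[1ₙ, 0]], and let S be a totally isotropic subspace of dimension s. Let N(S) be the set of g ∈ Sp_{2n}(𝔽_q) such that g fixes S pointwise and, for every v in the symplectic complement S^⊥ = {v : ⟨v, u⟩ = 0 for all u ∈ S}, the vector g·v − v lies in S. Then N(S) is a subgroup of Sp_{2n}(𝔽_q) of cardinality q^{s(s+1)/2 + 2s(n−s)}. -/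
open Matrix

/-- The standard symplectic structure matrix `J = [[0, -1ₙ],[1ₙ, 0]]` on `F^{2n} = F^n ⊕ F^n`. -/
def stdJ (n : ℕ) (F : Type*) [Field F] :
    Matrix (Fin n ⊕ Fin n) (Fin n ⊕ Fin n) F :=
  Matrix.fromBlocks 0 (-1) 1 0

/-- The standard symplectic form `⟨x, y⟩ = xᵀ J y` on `F^{2n}`. -/
def stdSymplForm {n : ℕ} {F : Type*} [Field F] (x y : Fin n ⊕ Fin n → F) : F :=
  x ⬝ᵥ ((stdJ n F) *ᵥ y)

/-- A matrix `g` is symplectic if it is invertible and preserves the standard symplectic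
form: `⟨g u, g v⟩ = ⟨u, v⟩` for all `u`, `v`. -/
def IsSymplectic {n : ℕ} {F : Type*} [Field F]
    (g : Matrix (Fin n ⊕ Fin n) (Fin n ⊕ Fin n) F) : Prop :=
  IsUnit g ∧ ∀ u v, stdSymplForm (g *ᵥ u) (g *ᵥ v) = stdSymplForm u v

/-- A subspace is totally isotropic if the standard symplectic form vanishes identically
on it. -/
def IsTotallyIsotropic {n : ℕ} {F : Type*} [Field F]
    (S : Submodule F (Fin n ⊕ Fin n → F)) : Prop :=
  ∀ u ∈ S, ∀ v ∈ S, stdSymplForm u v = 0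

section DualFamilies

open LinearMap (BilinForm)

variable {F V ι : Type*} [Field F] [AddCommGroup V] [Module F V]
  {B : BilinForm F V} {e t : ι → V}

/-- The isometries that fix `span e` pointwise and move every vector of its orthogonal complement
by an element of `span e`. -/
def unipotentRadical (B : BilinForm F V) (e : ι → V) : Set (V →ₗ[F] V) :=
  {g | (∀ u v, B (g u) (g v) = B u v) ∧ (∀ i, g (e i) = e i) ∧
    ∀ v, (∀ i, B (e i) v = 0) → g v - v ∈ Submodule.span F (Set.range e)}

/-- The possible displacements `g (t i) - t i` of a family `t` dual to `e` under elements `g` of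
`unipotentRadical B e`. -/
def displacements (B : BilinForm F V) (e t : ι → V) : Set (ι → V) :=
  {p | (∀ i j, B (e i) (p j) = 0) ∧ ∀ i j, B (p i) (t j) + B (t i) (p j) + B (p i) (p j) = 0}

theorem displacement_mem {g : V →ₗ[F] V} (hg : g ∈ unipotentRadical B e) :
    (fun i => g (t i) - t i) ∈ displacements B e t := by
  obtain ⟨hB, he, -⟩ := hg
  refine ⟨fun i j => ?_, fun i j => ?_⟩
  · have h := hB (e i) (t j)
    rw [he] at h
    simp [h]
  · have h := hB (t i) (t j)
    simp only [map_sub, LinearMap.sub_apply, h]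
    ring

/-- Pairing of a vector with the families `e` and `t`. -/
def dualCoordinates (B : BilinForm F V) (e t : ι → V) : V →ₗ[F] (ι → F) × (ι → F) :=
  (LinearMap.pi fun i => B (e i)).prod (LinearMap.pi fun j => B.flip (t j))

theorem mem_ker_dualCoordinates {v : V} :
    v ∈ LinearMap.ker (dualCoordinates B e t) ↔
      (∀ i, B (e i) v = 0) ∧ ∀ j, B v (t j) = 0 := by
  simp [dualCoordinates, funext_iff]

variable [Fintype ι]

/-- The isometry with prescribed displacements `p` of the dual family. -/
def isometryOfDisplacement (B : BilinForm F V) (e t p : ι → V) : V →ₗ[F] V :=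
  LinearMap.id + ∑ i, (B (e i)).smulRight (p i) -
    ∑ j, (B.flip (p j) - ∑ i, B (t i) (p j) • B (e i)).smulRight (e j)

theorem isometryOfDisplacement_apply_of_orthogonal (p : ι → V) {v : V}
    (hv : ∀ i, B (e i) v = 0) :
    isometryOfDisplacement B e t p v = v - ∑ j, B v (p j) • e j := by
  simp [isometryOfDisplacement, hv]

variable [DecidableEq ι]

theorem sub_sum_dual_mem_orthogonal (het : ∀ i j, B (e i) (t j) = if i = j then 1 else 0)
    (v : V) (k : ι) : B (e k) (v - ∑ i, B (e i) v • t i) = 0 := by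
  simp [het]

/-- If `e` and `t` are dual families, a linear map is determined by its values on `t` and on the
orthogonal complement of `e`. -/
theorem linearMap_ext_of_dual {M : Type*} [AddCommGroup M] [Module F M]
    (het : ∀ i j, B (e i) (t j) = if i = j then 1 else 0) {f g : V →ₗ[F] M}
    (ht : ∀ i, f (t i) = g (t i)) (hK : ∀ v, (∀ i, B (e i) v = 0) → f v = g v) : f = g := by
  ext v
  have h := hK _ (sub_sum_dual_mem_orthogonal het v)
  simpa [map_sub, map_sum, ht] using h

theorem eq_sum_of_mem_span (het : ∀ i j, B (e i) (t j) = if i = j then 1 else 0)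
    {x : V} (hx : x ∈ Submodule.span F (Set.range e)) : x = ∑ j, B x (t j) • e j := by
  obtain ⟨c, rfl⟩ := (Submodule.mem_span_range_iff_exists_fun F).1 hx
  simp [het]

theorem map_eq_sub_sum_of_mem_unipotentRadical
    (het : ∀ i j, B (e i) (t j) = if i = j then 1 else 0)
    {g : V →ₗ[F] V} (hg : g ∈ unipotentRadical B e) {v : V} (hv : ∀ i, B (e i) v = 0) :
    g v = v - ∑ j, B v (g (t j) - t j) • e j := by
  have hp := (displacement_mem (t := t) hg).1
  have hmem := hg.2.2 v hv
  have key : ∀ j, B (g v - v) (t j) = - B v (g (t j) - t j) := by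
    intro j
    have h₁ := hg.1 v (t j)
    have h₂ : B (g v - v) (g (t j) - t j) = 0 := by
      conv_lhs => rw [eq_sum_of_mem_span het hmem]
      simp only [map_sum, LinearMap.sum_apply, map_smul, LinearMap.smul_apply, hp, smul_zero,
        Finset.sum_const_zero]
    simp only [map_sub, LinearMap.sub_apply] at h₂ ⊢
    linear_combination h₁ - h₂
  have h := eq_sum_of_mem_span het hmem
  simp only [key, neg_smul, Finset.sum_neg_distrib] at h
  rw [sub_eq_iff_eq_add.1 h]
  abel

theorem isometryOfDisplacement_apply_dual
    (het : ∀ i j, B (e i) (t j) = if i = j then 1 else 0) (p : ι → V) (k : ι) :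
    isometryOfDisplacement B e t p (t k) = t k + p k := by
  simp [isometryOfDisplacement, het]

theorem isometryOfDisplacement_mem (hB : B.IsAlt) (he : ∀ i j, B (e i) (e j) = 0)
    (het : ∀ i j, B (e i) (t j) = if i = j then 1 else 0) {p : ι → V}
    (hp : p ∈ displacements B e t) : isometryOfDisplacement B e t p ∈ unipotentRadical B e := by
  have hK {v : V} (hv : ∀ i, B (e i) v = 0) :=
    isometryOfDisplacement_apply_of_orthogonal (t := t) p hv
  have hT := isometryOfDisplacement_apply_dual het p
  have hs : ∀ u v, B u v = - B v u := fun u v => (hB.neg_eq v u).symm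
  set g := isometryOfDisplacement B e t p
  have hiso : B.compl₁₂ g g = B := by
    have htK : ∀ i v, (∀ k, B (e k) v = 0) → B (g v) (g (t i)) = B v (t i) := by
      intro i v hv
      rw [hK hv, hT]
      simp [het, hp.1]
    refine linearMap_ext_of_dual het (fun i => ?_) fun v hv => ?_ <;>
      refine linearMap_ext_of_dual het (fun j => ?_) fun w hw => ?_
    · have := hp.2 i j
      simp only [LinearMap.compl₁₂_apply, hT, map_add, LinearMap.add_apply]
      linear_combination this
    · rw [LinearMap.compl₁₂_apply, hs, htK i w hw, ← hs]
    · rw [LinearMap.compl₁₂_apply, htK j v hv]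
    · have hv' : ∀ i, B v (e i) = 0 := fun i => by rw [hs, hv, neg_zero]
      simp [LinearMap.compl₁₂_apply, hK hv, hK hw, hw, hv', he]
  refine ⟨fun u v => ?_, fun i => ?_, fun v hv => ?_⟩
  · conv_rhs => rw [← hiso]
    rfl
  · rw [hK fun k => he k i]
    simp [hp.1]
  · rw [hK hv, sub_sub_cancel_left]
    exact neg_mem <| sum_mem fun j _ =>
      Submodule.smul_mem _ _ (Submodule.subset_span (Set.mem_range_self j))

theorem card_unipotentRadical_eq_card_displacements (hB : B.IsAlt)
    (he : ∀ i j, B (e i) (e j) = 0) (het : ∀ i j, B (e i) (t j) = if i = j then 1 else 0) :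
    Nat.card (unipotentRadical B e) = Nat.card (displacements B e t) := by
  refine Nat.card_eq_of_bijective (fun g => ⟨_, displacement_mem g.2⟩) ⟨fun g h hgh => ?_, ?_⟩
  · have hd : ∀ i, g.1 (t i) - t i = h.1 (t i) - t i := congrFun (congrArg Subtype.val hgh)
    refine Subtype.ext (linearMap_ext_of_dual het (fun i => sub_left_injective (hd i)) ?_)
    intro v hv
    rw [map_eq_sub_sum_of_mem_unipotentRadical het g.2 hv,
      map_eq_sub_sum_of_mem_unipotentRadical het h.2 hv]
    simp only [hd]
  · intro p
    refine ⟨⟨_, isometryOfDisplacement_mem hB he het p.2⟩, Subtype.ext (funext fun i => ?_)⟩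
    simp [isometryOfDisplacement_apply_dual het]

theorem dualCoordinates_surjective (he : ∀ i j, B (e i) (e j) = 0)
    (het : ∀ i j, B (e i) (t j) = if i = j then 1 else 0) :
    Function.Surjective (dualCoordinates B e t) := by
  rintro ⟨a, b⟩
  let u := ∑ i, a i • t i
  refine ⟨u + ∑ j, (b j - B u (t j)) • e j, Prod.ext (funext fun i => ?_) (funext fun j => ?_)⟩
  · simp [dualCoordinates, u, he, het]
  · change B (u + ∑ j, (b j - B u (t j)) • e j) (t j) = b j
    simp [het]

theorem finrank_ker_dualCoordinates [FiniteDimensional F V] (he : ∀ i j, B (e i) (e j) = 0)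
    (het : ∀ i j, B (e i) (t j) = if i = j then 1 else 0) :
    2 * Fintype.card ι + Module.finrank F (LinearMap.ker (dualCoordinates B e t)) =
      Module.finrank F V := by
  rw [← LinearMap.finrank_range_add_finrank_ker (dualCoordinates B e t),
    LinearMap.range_eq_top.2 (dualCoordinates_surjective he het), finrank_top]
  simp [two_mul]

theorem sub_sum_mem_ker_dualCoordinates (he : ∀ i j, B (e i) (e j) = 0)
    (het : ∀ i j, B (e i) (t j) = if i = j then 1 else 0) {v : V} (hv : ∀ i, B (e i) v = 0) :
    v - ∑ j, B v (t j) • e j ∈ LinearMap.ker (dualCoordinates B e t) := by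
  refine mem_ker_dualCoordinates.2 ⟨fun i => ?_, fun j => ?_⟩ <;> simp [hv, he, het]

theorem card_displacements [LinearOrder ι] (hB : B.IsAlt) (he : ∀ i j, B (e i) (e j) = 0)
    (het : ∀ i j, B (e i) (t j) = if i = j then 1 else 0) :
    Nat.card (displacements B e t) =
      Nat.card ((ι → LinearMap.ker (dualCoordinates B e t)) ×
        ({x : ι × ι // x.1 ≤ x.2} → F)) := by
  have hs : ∀ u v, B u v = - B v u := fun u v => (hB.neg_eq v u).symm
  refine Nat.card_eq_of_bijective
    (fun p => (fun i => ⟨_, sub_sum_mem_ker_dualCoordinates he het fun k => p.2.1 k i⟩,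
      fun x => B (p.1 x.1.1) (t x.1.2))) ⟨?_, ?_⟩
  · rintro ⟨p, hp⟩ ⟨r, hr⟩ hpr
    simp only [Prod.mk.injEq, funext_iff, Subtype.ext_iff, Subtype.forall, Prod.forall] at hpr
    obtain ⟨hw, hb⟩ := hpr
    have hpp {p : ι → V} (hp : p ∈ displacements B e t) (i j : ι) : B (p i) (p j) =
        B (p i - ∑ k, B (p i) (t k) • e k) (p j - ∑ k, B (p j) (t k) • e k) := by
      have h' : ∀ i j, B (p i) (e j) = 0 := fun i j => by rw [hs, hp.1, neg_zero]
      simp [hp.1, h', he]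
    have hb' : ∀ i j, B (p i) (t j) = B (r i) (t j) := by
      intro i j
      rcases le_total i j with hij | hij
      · exact hb i j hij
      · have h₁ := hp.2 i j
        have h₂ := hr.2 i j
        rw [hs (t i), hb j i hij, hpp hp, hw, hw, ← hpp hr] at h₁
        rw [hs (t i)] at h₂
        linear_combination h₁ - h₂
    refine Subtype.ext (funext fun i => ?_)
    simpa [hb'] using hw i
  · rintro ⟨w, b⟩
    have hw : ∀ i, (∀ k, B (e k) (w i) = 0) ∧ ∀ k, B (w i) (t k) = 0 :=
      fun i => mem_ker_dualCoordinates.1 (w i).2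
    let c : ι → ι → F := fun i j =>
      if h : i ≤ j then b ⟨(i, j), h⟩ else b ⟨(j, i), (not_le.1 h).le⟩ - B (w i) (w j)
    have hc : ∀ i j, c i j - c j i + B (w i) (w j) = 0 := by
      intro i j
      rcases lt_trichotomy i j with h | rfl | h
      · simp [c, h.le, h.not_ge, hs (w i) (w j)]
      · simp [hB.self_eq_zero]
      · simp [c, h.le, h.not_ge]
    have hwe : ∀ i j, B (w i) (e j) = 0 := fun i j => by rw [hs, (hw i).1, neg_zero]
    let p : ι → V := fun i => w i + ∑ j, c i j • e j
    have hpt : ∀ i j, B (p i) (t j) = c i j := fun i j => by simp [p, hw, het]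
    refine ⟨⟨p, fun i j => by simp [p, hw, he], fun i j => ?_⟩, ?_⟩
    · rw [hs (t i), hpt, hpt, ← hc i j]
      simp [p, hwe, hw, he, sub_eq_add_neg]
    · refine Prod.ext (funext fun i => Subtype.ext ?_) (funext fun x => ?_)
      · simp only [hpt]
        simp [p]
      · simp only [hpt]
        simp [c, x.2]

theorem card_unipotentRadical [LinearOrder ι] [Fintype F] [FiniteDimensional F V]
    (hB : B.IsAlt) (he : ∀ i j, B (e i) (e j) = 0)
    (het : ∀ i j, B (e i) (t j) = if i = j then 1 else 0) :
    Nat.card (unipotentRadical B e) = Fintype.card F ^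
      (Fintype.card ι * (Fintype.card ι + 1) / 2 +
        Fintype.card ι * (Module.finrank F V - 2 * Fintype.card ι)) := by
  rw [card_unipotentRadical_eq_card_displacements hB he het, card_displacements hB he het,
    Nat.card_prod, Nat.card_fun, Nat.card_fun, Module.natCard_eq_pow_finrank (K := F),
    ← finrank_ker_dualCoordinates he het, Nat.add_sub_cancel_left, ← pow_mul, ← pow_add,
    Nat.card_congr (Sym2.sortEquiv (α := ι)).symm, Nat.card_eq_fintype_card (α := Sym2 ι),
    Sym2.card, Nat.choose_two_right, Nat.card_eq_fintype_card, Nat.card_eq_fintype_card]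
  congr 1
  rw [Nat.add_sub_cancel, mul_comm (Fintype.card ι + 1), mul_comm (Module.finrank F _), add_comm]

end DualFamilies

section StandardForm

variable {n : ℕ} {F : Type*} [Field F]

/-- The standard symplectic form as a bilinear form. -/
def stdSymplBilin (n : ℕ) (F : Type*) [Field F] : LinearMap.BilinForm F (Fin n ⊕ Fin n → F) :=
  Matrix.toBilin' (stdJ n F)

theorem stdSymplBilin_apply (u v : Fin n ⊕ Fin n → F) :
    stdSymplBilin n F u v = stdSymplForm u v :=
  Matrix.toBilin'_apply' _ _ _

theorem stdSymplBilin_isAlt : (stdSymplBilin n F).IsAlt := by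
  intro v
  rw [stdSymplBilin_apply]
  simp [stdSymplForm, stdJ, dotProduct, Matrix.fromBlocks_mulVec, Matrix.neg_mulVec, mul_comm]

theorem stdJ_mul_stdJ : stdJ n F * stdJ n F = -1 :=
  Matrix.J_squared (Fin n) F

theorem exists_stdSymplBilin_eq (f : Module.Dual F (Fin n ⊕ Fin n → F)) :
    ∃ t, ∀ v, stdSymplBilin n F v t = f v := by
  obtain ⟨w, rfl⟩ := (dotProductEquiv F (Fin n ⊕ Fin n)).surjective f
  refine ⟨-(stdJ n F *ᵥ w), fun v => ?_⟩
  rw [stdSymplBilin_apply, stdSymplForm, Matrix.mulVec_neg, Matrix.mulVec_mulVec, stdJ_mul_stdJ]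
  simp [Matrix.neg_mulVec, dotProduct_comm]

theorem exists_dual_family {ι : Type*} [DecidableEq ι]
    {S : Submodule F (Fin n ⊕ Fin n → F)} (b : Module.Basis ι F S) :
    ∃ t : ι → Fin n ⊕ Fin n → F, ∀ i j, stdSymplBilin n F (b i) (t j) = if i = j then 1 else 0 := by
  have h : ∀ j, ∃ t, ∀ i, stdSymplBilin n F (b i) t = if i = j then 1 else 0 := by
    intro j
    obtain ⟨f, hf⟩ := (b.coord j).exists_extend
    obtain ⟨t, ht⟩ := exists_stdSymplBilin_eq f
    refine ⟨t, fun i => ?_⟩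
    rw [ht, ← S.subtype_apply, ← LinearMap.comp_apply, hf]
    simp [Finsupp.single_apply]
  choose t ht using h
  exact ⟨t, fun i j => ht j i⟩

theorem isUnit_of_isometry {g : Matrix (Fin n ⊕ Fin n) (Fin n ⊕ Fin n) F}
    (hg : ∀ u v, stdSymplForm (g *ᵥ u) (g *ᵥ v) = stdSymplForm u v) : IsUnit g := by
  rw [← Matrix.mulVec_injective_iff_isUnit]
  refine (injective_iff_map_eq_zero g.mulVecLin).2 fun v hv => ?_
  rw [Matrix.mulVecLin_apply] at hv
  refine (dotProductEquiv F (Fin n ⊕ Fin n)).injective (LinearMap.ext fun u => ?_)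
  obtain ⟨t, ht⟩ := exists_stdSymplBilin_eq (dotProductEquiv F (Fin n ⊕ Fin n) u)
  have h := ht v
  rw [stdSymplBilin_apply, ← hg, hv] at h
  simpa [stdSymplForm, dotProduct_comm] using h.symm

theorem mem_unipotentRadical_toLin'_iff {ι : Type*} [Fintype ι]
    {S : Submodule F (Fin n ⊕ Fin n → F)} (b : Module.Basis ι F S)
    (g : Matrix (Fin n ⊕ Fin n) (Fin n ⊕ Fin n) F) :
    Matrix.toLin' g ∈ unipotentRadical (stdSymplBilin n F) (fun i => (b i : Fin n ⊕ Fin n → F)) ↔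
      IsSymplectic g ∧ (∀ v ∈ S, g *ᵥ v = v) ∧
        ∀ v : Fin n ⊕ Fin n → F, (∀ u ∈ S, stdSymplForm v u = 0) → g *ᵥ v - v ∈ S := by
  have hspan : Submodule.span F (Set.range fun i => (b i : Fin n ⊕ Fin n → F)) = S := by
    have h := congrArg (Submodule.map S.subtype) b.span_eq
    rwa [Submodule.map_span, ← Set.range_comp, Submodule.map_subtype_top] at h
  have hfix : (∀ i, g *ᵥ (b i : Fin n ⊕ Fin n → F) = b i) ↔ ∀ v ∈ S, g *ᵥ v = v := by
    refine ⟨fun h v hv => ?_, fun h i => h _ (b i).2⟩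
    have := b.ext (f₁ := Matrix.toLin' g ∘ₗ S.subtype) (f₂ := S.subtype) (by simpa using h)
    simpa using LinearMap.congr_fun this ⟨v, hv⟩
  have horth : ∀ v, (∀ i, stdSymplBilin n F (b i) v = 0) ↔ ∀ u ∈ S, stdSymplForm v u = 0 := by
    intro v
    have hs : ∀ u, stdSymplForm v u = - stdSymplBilin n F u v := fun u => by
      rw [← stdSymplBilin_apply, stdSymplBilin_isAlt.neg_eq]
    simp only [hs, neg_eq_zero]
    refine ⟨fun h u hu => ?_, fun h i => h _ (b i).2⟩
    have := b.ext (f₁ := (stdSymplBilin n F).flip v ∘ₗ S.subtype) (f₂ := 0) (by simpa using h)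
    simpa using LinearMap.congr_fun this ⟨u, hu⟩
  simp only [unipotentRadical, Set.mem_ofPred_eq, hspan, horth, Matrix.toLin'_apply, hfix]
  simp only [stdSymplBilin_apply, IsSymplectic]
  exact ⟨fun h => ⟨⟨isUnit_of_isometry h.1, h.1⟩, h.2⟩, fun h => ⟨h.1.2, h.2⟩⟩

theorem IsSymplectic.mul {g h : Matrix (Fin n ⊕ Fin n) (Fin n ⊕ Fin n) F}
    (hg : IsSymplectic g) (hh : IsSymplectic h) : IsSymplectic (g * h) :=
  ⟨hg.1.mul hh.1, fun u v => by
    rw [← Matrix.mulVec_mulVec, ← Matrix.mulVec_mulVec, hg.2, hh.2]⟩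

theorem IsSymplectic.of_mul_eq_one {g h : Matrix (Fin n ⊕ Fin n) (Fin n ⊕ Fin n) F}
    (hg : IsSymplectic g) (hgh : g * h = 1) : IsSymplectic h :=
  ⟨IsUnit.of_mul_eq_one _ (mul_eq_one_comm.1 hgh), fun u v => by
    rw [← hg.2, Matrix.mulVec_mulVec, Matrix.mulVec_mulVec, hgh, Matrix.one_mulVec,
      Matrix.one_mulVec]⟩

end StandardForm

/-- Let `F` be a finite field with `q` elements and `S` a totally isotropic
subspace of `F^{2n}` of dimension `s`. The set `N(S)` of symplectic matrices fixing `S`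
pointwise and moving every vector of the symplectic complement `S^⊥` by an element of `S`
is a subgroup of the symplectic group, of cardinality `q^{s(s+1)/2 + 2s(n-s)}`. -/
theorem unipotent_radical_subgroup_card
    (F : Type*) [Field F] [Fintype F] (n s : ℕ)
    (S : Submodule F (Fin n ⊕ Fin n → F))
    (hS : IsTotallyIsotropic S) (hs : Module.finrank F S = s) :
    ∀ N : Set (Matrix (Fin n ⊕ Fin n) (Fin n ⊕ Fin n) F),
      N = {g | IsSymplectic g ∧ (∀ v ∈ S, g *ᵥ v = v) ∧
            ∀ v : Fin n ⊕ Fin n → F, (∀ u ∈ S, stdSymplForm v u = 0) → g *ᵥ v - v ∈ S} →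
      (1 : Matrix (Fin n ⊕ Fin n) (Fin n ⊕ Fin n) F) ∈ N ∧
      (∀ g ∈ N, ∀ h ∈ N, g * h ∈ N) ∧
      (∀ g ∈ N, ∀ h, g * h = 1 → h ∈ N) ∧
      (∀ g ∈ N, IsSymplectic g) ∧
      Nat.card N = Fintype.card F ^ (s * (s + 1) / 2 + 2 * s * (n - s)) := by
  rintro N rfl
  refine ⟨⟨⟨isUnit_one, by simp⟩, by simp, by simp⟩, ?_, ?_, fun g hg => hg.1, ?_⟩
  · rintro g ⟨hg, hgS, hgK⟩ h ⟨hh, hhS, hhK⟩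
    refine ⟨hg.mul hh, fun v hv => ?_, fun v hv => ?_⟩
    · rw [← Matrix.mulVec_mulVec, hhS v hv, hgS v hv]
    · have h₁ := hgS _ (hhK v hv)
      rw [Matrix.mulVec_sub, sub_eq_iff_eq_add] at h₁
      rw [← Matrix.mulVec_mulVec, h₁, add_sub_assoc]
      exact S.add_mem (hhK v hv) (hgK v hv)
  · rintro g ⟨hg, hgS, hgK⟩ h hgh
    have hhg (v : Fin n ⊕ Fin n → F) : h *ᵥ (g *ᵥ v) = v := by
      rw [Matrix.mulVec_mulVec, mul_eq_one_comm.1 hgh, Matrix.one_mulVec]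
    have hhS : ∀ v ∈ S, h *ᵥ v = v := fun v hv => by
      conv_lhs => rw [← hgS v hv, hhg]
    refine ⟨hg.of_mul_eq_one hgh, hhS, fun v hv => ?_⟩
    have h₁ := hhS _ (hgK v hv)
    rw [Matrix.mulVec_sub, hhg] at h₁
    rw [← neg_sub, h₁]
    exact S.neg_mem (hgK v hv)
  · let b := Module.finBasisOfFinrankEq F S hs
    obtain ⟨t, ht⟩ := exists_dual_family b
    have hcard := card_unipotentRadical (e := fun i => (b i : Fin n ⊕ Fin n → F))
      stdSymplBilin_isAlt
      (fun i j => (stdSymplBilin_apply _ _).trans (hS _ (b i).2 _ (b j).2)) ht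
    refine (Nat.card_congr (Matrix.toLin'.toEquiv.subtypeEquiv fun g =>
      (mem_unipotentRadical_toLin'_iff b g).symm)).trans (hcard.trans ?_)
    rw [Fintype.card_fin, Module.finrank_fintype_fun_eq_card, Fintype.card_sum, Fintype.card_fin,
      ← two_mul, ← Nat.mul_sub, mul_left_comm, mul_assoc]
end

section
/- Let q be a prime power, let V = 𝔽_q^{2n} carry the standard symplectic form ⟨x, y⟩ = xᵀ J y with J = [[0, -1ₙ],[1ₙ, 0]], and let S be a totally isotropic subspace of dimension s. Let P(S) = {g ∈ Sp_{2n}(𝔽_q) : g·S = S} be the stabilizer of S. Then |P(S)| = q^{s(s+1)/2 + 2s(n−s)} · ( Π_{i=0}^{s−1} (q^s − q^i) ) · ( q^{(n−s)²} · Π_{i=1}^{n−s} (q^{2i} − 1) ), i.e., |P(S)| equals the product of |N(S)|, |GL_s(𝔽_q)|, and |Sp_{2(n−s)}(𝔽_q)|. -/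
open Matrix

/-- Counting pairs by their first component, when each one extends in `c` ways. -/
theorem card_eq_card_mul_of_prodEquiv {A W C : Type*} [Finite A] [Finite W] {c : ℕ}
    (e : A × W ≃ C) {P : C → Prop} {Q : A → Prop} {R : A → W → Prop}
    (hP : ∀ v w, P (e (v, w)) ↔ Q v ∧ R v w) (hR : ∀ v, Q v → Nat.card {w | R v w} = c) :
    Nat.card {x | P x} = Nat.card {v | Q v} * c := by
  have e₁ : {p : A × W | Q p.1 ∧ R p.1 p.2} ≃ {x | P x} :=
    e.subtypeEquiv fun p => (hP p.1 p.2).symm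
  have e₂ : {p : A × W | Q p.1 ∧ R p.1 p.2} ≃ Σ v : {v | Q v}, {w | R v.1 w} :=
    { toFun := fun p => ⟨⟨p.1.1, p.2.1⟩, ⟨p.1.2, p.2.2⟩⟩
      invFun := fun x => ⟨(x.1.1, x.2.1), x.1.2, x.2.2⟩
      left_inv := fun _ => rfl
      right_inv := fun _ => rfl }
  cases nonempty_fintype {v | Q v}
  rw [← Nat.card_congr e₁, Nat.card_congr e₂, Nat.card_sigma,
    Finset.sum_congr rfl fun v _ => hR v.1 v.2]
  simp [Nat.card_eq_fintype_card]

/-- Counting tuples by their initial segment, when each one extends in `c` ways. -/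
theorem card_eq_card_mul_of_snoc {k c : ℕ} {W : Type*} [Finite W] {P : (Fin (k + 1) → W) → Prop}
    {Q : (Fin k → W) → Prop} {R : (Fin k → W) → W → Prop}
    (hP : ∀ v w, P (Fin.snoc v w) ↔ Q v ∧ R v w)
    (hR : ∀ v, Q v → Nat.card {w | R v w} = c) :
    Nat.card {v | P v} = Nat.card {v | Q v} * c :=
  card_eq_card_mul_of_prodEquiv ((Equiv.prodComm _ _).trans (Fin.snocEquiv fun _ => W)) hP hR

section Frames

variable {F V : Type*} [Field F] [AddCommGroup V] [Module F V]

/-- Evaluation of a nondegenerate form against a linearly independent family is surjective. -/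
theorem surjective_pi_of_linearIndependent {ι : Type*} [Finite ι] {B : V →ₗ[F] V →ₗ[F] F}
    (hB : B.SeparatingLeft) {v : ι → V} (hv : LinearIndependent F v) :
    Function.Surjective (LinearMap.pi fun i => B (v i)) := by
  classical
  cases nonempty_fintype ι
  rw [← LinearMap.range_eq_top]
  by_contra h
  obtain ⟨f, hf, hle⟩ := Submodule.exists_le_ker_of_lt_top _ (lt_top_iff_ne_top.mpr h)
  have hsum : ∑ i, f (Pi.single i 1) • v i = 0 := by
    refine hB _ fun w => ?_
    have hw : f (LinearMap.pi (fun i => B (v i)) w) = 0 := hle ⟨w, rfl⟩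
    rw [pi_eq_sum_univ' (LinearMap.pi (fun i => B (v i)) w), map_sum] at hw
    simpa [mul_comm, Pi.single, Function.update_apply] using hw
  have hzero := Fintype.linearIndependent_iff.mp hv _ hsum
  refine hf (LinearMap.pi_ext' fun i => LinearMap.ext_ring ?_)
  simpa using hzero i

/-- A linearly independent isotropic family whose first `s` members lie in `S`. -/
def IsIsotropicFrame (B : V →ₗ[F] V →ₗ[F] F) (S : Submodule F V) (s : ℕ) {k : ℕ}
    (v : Fin k → V) : Prop :=
  LinearIndependent F v ∧ (∀ i j, B (v i) (v j) = 0) ∧ ∀ i : Fin k, (i : ℕ) < s → v i ∈ S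

/-- A family `f` spanning an isotropic subspace and dual up to sign to the family `e`. -/
def IsDualFrame (B : V →ₗ[F] V →ₗ[F] F) {n k : ℕ} (e : Fin n → V) (f : Fin k → V) : Prop :=
  (∀ i j, B (e i) (f j) = if (i : ℕ) = j then -1 else 0) ∧ ∀ i j, B (f i) (f j) = 0

theorem IsDualFrame.linearIndependent {B : V →ₗ[F] V →ₗ[F] F} {n k : ℕ} (hk : k ≤ n)
    {e : Fin n → V} {f : Fin k → V} (h : IsDualFrame B e f) (he : LinearIndependent F e)
    (hiso : ∀ i j, B (e i) (e j) = 0) : LinearIndependent F (Sum.elim e f) := by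
  rw [Fintype.linearIndependent_iff]
  intro g hg
  simp only [Fintype.sum_sum_type, Sum.elim_inl, Sum.elim_inr] at hg
  have hr : ∀ j, g (Sum.inr j) = 0 := fun j => by
    have := congrArg (B (e (Fin.castLE hk j))) hg
    simpa [hiso, h.1, Fin.val_inj] using this
  have hl : ∀ i, g (Sum.inl i) = 0 := by
    refine Fintype.linearIndependent_iff.mp he _ ?_
    simpa [hr] using hg
  exact Sum.rec hl hr

variable [Fintype F] [FiniteDimensional F V]

/-- Pairing with a linearly independent family takes each prescribed value equally often. -/
theorem card_pairing_eq {ι : Type*} [Finite ι] {B : V →ₗ[F] V →ₗ[F] F}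
    (hB : B.SeparatingLeft) {v : ι → V} (hv : LinearIndependent F v) (c : ι → F) :
    Nat.card {w | ∀ i, B (v i) w = c i} =
      Fintype.card F ^ (Module.finrank F V - Nat.card ι) := by
  cases nonempty_fintype ι
  have hsurj := surjective_pi_of_linearIndependent hB hv
  obtain ⟨w₀, hw₀⟩ := hsurj c
  have hw₀' : ∀ i, B (v i) w₀ = c i := fun i => congrFun hw₀ i
  have e : {w | ∀ i, B (v i) w = c i} ≃ LinearMap.ker (LinearMap.pi fun i => B (v i)) :=
    (Equiv.subRight w₀).subtypeEquiv fun w => by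
      simp [funext_iff, hw₀', sub_eq_zero]
  have hrank := LinearMap.finrank_range_add_finrank_ker (LinearMap.pi fun i => B (v i))
  rw [LinearMap.range_eq_top.mpr hsurj, finrank_top, Module.finrank_fintype_fun_eq_card] at hrank
  rw [Nat.card_congr e, Module.natCard_eq_pow_finrank (K := F), Nat.card_eq_fintype_card,
    Nat.card_eq_fintype_card, ← hrank, Nat.add_sub_cancel_left]

/-- Number of vectors of a subspace outside a smaller one. -/
theorem card_mem_not_mem {E W : Submodule F V} (h : E ≤ W) :
    Nat.card {w | w ∈ W ∧ w ∉ E} =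
      Fintype.card F ^ Module.finrank F W - Fintype.card F ^ Module.finrank F E := by
  have : Finite V := Module.finite_of_finite F
  have := Set.ncard_sdiff (s := (E : Set V)) (t := (W : Set V)) h
  rw [← Nat.card_coe_set_eq, ← Nat.card_coe_set_eq, ← Nat.card_coe_set_eq] at this
  have hW := Module.natCard_eq_pow_finrank (K := F) (V := W)
  have hE := Module.natCard_eq_pow_finrank (K := F) (V := E)
  rw [Nat.card_eq_fintype_card (α := F)] at hW hE
  rw [← hW, ← hE]
  exact this

theorem card_isIsotropicFrame {B : V →ₗ[F] V →ₗ[F] F} (hB : B.SeparatingLeft) (hA : B.IsAlt)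
    {S : Submodule F V} (hS : ∀ u ∈ S, ∀ v ∈ S, B u v = 0) (k : ℕ) :
    Nat.card {v : Fin k → V | IsIsotropicFrame B S (Module.finrank F S) v} =
      ∏ i ∈ Finset.range k, if i < Module.finrank F S
        then Fintype.card F ^ Module.finrank F S - Fintype.card F ^ i
        else Fintype.card F ^ (Module.finrank F V - i) - Fintype.card F ^ i := by
  have : Finite V := Module.finite_of_finite F
  induction k with
  | zero =>
    simp [IsIsotropicFrame]
  | succ k ih =>
    rw [Finset.prod_range_succ, ← ih]
    refine card_eq_card_mul_of_snoc (R := fun v w =>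
      ((∀ i, B (v i) w = 0) ∧ (k < Module.finrank F S → w ∈ S)) ∧ w ∉ Submodule.span F (Set.range v)) (fun v w => ?_) fun v hv => ?_
    · simp only [IsIsotropicFrame, linearIndependent_finSnoc, Fin.forall_fin_succ',
        Fin.snoc_castSucc, Fin.snoc_last, Fin.val_castSucc, Fin.val_last, hA.self_eq_zero w]
      have hsymm : (∀ i, B w (v i) = 0) ↔ ∀ i, B (v i) w = 0 :=
        forall_congr' fun i => hA.isRefl.eq_iff
      grind
    · obtain ⟨hli, hiso, hmem⟩ := hv
      have hE : Module.finrank F (Submodule.span F (Set.range v)) = k := by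
        simpa using finrank_span_eq_card hli
      split_ifs with hk
      · have hvS : ∀ i, v i ∈ S := fun i => hmem i (i.2.trans hk)
        have hle : Submodule.span F (Set.range v) ≤ S := by
          rw [Submodule.span_le]; rintro _ ⟨i, rfl⟩; exact hvS i
        conv_rhs => rw [← hE]
        rw [← card_mem_not_mem hle]
        congr! 4 with w
        exact and_congr_left fun _ =>
          ⟨fun h => h.2 hk, fun h => ⟨fun i => hS _ (hvS i) _ h, fun _ => h⟩⟩
      · set W : Submodule F V := LinearMap.ker (LinearMap.pi fun i => B (v i)) with hW
        have hWmem : ∀ w, w ∈ W ↔ ∀ i, B (v i) w = 0 := fun w => by simp [hW, funext_iff]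
        have hcard := card_pairing_eq hB hli 0
        have hle : Submodule.span F (Set.range v) ≤ W := by
          rw [Submodule.span_le]; rintro _ ⟨j, rfl⟩; exact (hWmem _).mpr fun i => hiso i j
        have hWcard : Nat.card W = Fintype.card F ^ (Module.finrank F V - k) := by
          rw [Nat.card_fin] at hcard
          rw [← hcard]
          exact Nat.card_congr (Equiv.subtypeEquivRight hWmem)
        rw [Module.natCard_eq_pow_finrank (K := F), Nat.card_eq_fintype_card] at hWcard
        rw [← hWcard]
        conv_rhs => rw [← hE]
        rw [← card_mem_not_mem hle]
        congr! 4 with w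
        simp [hWmem, hk]

theorem card_isDualFrame {B : V →ₗ[F] V →ₗ[F] F} (hB : B.SeparatingLeft) (hA : B.IsAlt)
    {n k : ℕ} (hk : k ≤ n) {e : Fin n → V} (he : LinearIndependent F e)
    (hiso : ∀ i j, B (e i) (e j) = 0) :
    Nat.card {f : Fin k → V | IsDualFrame B e f} =
      ∏ j ∈ Finset.range k, Fintype.card F ^ (Module.finrank F V - (n + j)) := by
  have : Finite V := Module.finite_of_finite F
  induction k with
  | zero => simp [IsDualFrame]
  | succ k ih =>
    rw [Finset.prod_range_succ, ← ih (by omega)]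
    refine card_eq_card_mul_of_snoc (R := fun f w => ∀ x, B (Sum.elim e f x) w =
      Sum.elim (fun i : Fin n => if (i : ℕ) = k then -1 else 0) 0 x) (fun f w => ?_) fun f hf => ?_
    · simp only [IsDualFrame, Fin.forall_fin_succ', Fin.snoc_castSucc, Fin.snoc_last,
        Fin.val_castSucc, Fin.val_last, hA.self_eq_zero w, Sum.forall, Sum.elim_inl, Sum.elim_inr,
        Pi.zero_apply]
      have hsymm : (∀ i, B w (f i) = 0) ↔ ∀ i, B (f i) w = 0 :=
        forall_congr' fun i => hA.isRefl.eq_iff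
      grind
    · rw [card_pairing_eq hB (hf.linearIndependent (by omega) he hiso)]
      simp

end Frames

theorem symplectic_frame_count_eq (q s m : ℕ) :
    (∏ i ∈ Finset.range (s + m), if i < s then q ^ s - q ^ i
        else q ^ (2 * (s + m) - i) - q ^ i) *
      ∏ j ∈ Finset.range (s + m), q ^ (2 * (s + m) - (s + m + j)) =
    q ^ (s * (s + 1) / 2 + 2 * s * m) * (∏ i ∈ Finset.range s, (q ^ s - q ^ i)) *
      (q ^ (m ^ 2) * ∏ i ∈ Finset.Icc 1 m, (q ^ (2 * i) - 1)) := by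
  have hlow : ∏ i ∈ Finset.range s, (if i < s then q ^ s - q ^ i
      else q ^ (2 * (s + m) - i) - q ^ i) = ∏ i ∈ Finset.range s, (q ^ s - q ^ i) :=
    Finset.prod_congr rfl fun i hi => if_pos (Finset.mem_range.mp hi)
  have hhigh : ∏ j ∈ Finset.range m, (if s + j < s then q ^ s - q ^ (s + j)
      else q ^ (2 * (s + m) - (s + j)) - q ^ (s + j)) =
      (∏ j ∈ Finset.range m, q ^ (s + j)) * ∏ i ∈ Finset.Icc 1 m, (q ^ (2 * i) - 1) := by
    have hreflect : ∏ i ∈ Finset.Icc 1 m, (q ^ (2 * i) - 1) =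
        ∏ j ∈ Finset.range m, (q ^ (2 * (m - j)) - 1) := by
      rw [← Finset.Ico_succ_right_eq_Icc, Finset.prod_Ico_eq_prod_range,
        ← Finset.prod_range_reflect]
      refine Finset.prod_congr (by simp) fun j hj => ?_
      have := Finset.mem_range.mp hj
      simp only [Order.succ_eq_add_one] at *
      congr 3
      omega
    rw [hreflect, ← Finset.prod_mul_distrib]
    refine Finset.prod_congr rfl fun j hj => ?_
    have := Finset.mem_range.mp hj
    rw [if_neg (by omega), Nat.mul_sub, mul_one, ← pow_add]
    congr 2
    omega
  have hdual : ∏ j ∈ Finset.range (s + m), q ^ (2 * (s + m) - (s + m + j)) =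
      ∏ j ∈ Finset.range (s + m), q ^ (j + 1) := by
    rw [← Finset.prod_range_reflect]
    refine Finset.prod_congr rfl fun j hj => ?_
    have := Finset.mem_range.mp hj
    congr 1
    omega
  have hpow : (∏ j ∈ Finset.range m, q ^ (s + j)) * ∏ j ∈ Finset.range (s + m), q ^ (j + 1) =
      q ^ (s * (s + 1) / 2 + 2 * s * m + m ^ 2) := by
    rw [Finset.prod_pow_eq_pow_sum, Finset.prod_pow_eq_pow_sum, ← pow_add]
    congr 1
    clear hlow hhigh hdual
    induction m with
    | zero =>
      have := Finset.sum_range_id_mul_two (s + 1)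
      rw [Finset.sum_range_succ'] at this
      simp at this ⊢
      rw [mul_comm s]
      omega
    | succ m ih =>
      rw [Finset.sum_range_succ, ← add_assoc s m 1, Finset.sum_range_succ _ (s + m)]
      linarith [ih]
  rw [Finset.prod_range_add, hlow, hhigh, hdual]
  rw [pow_add _ (_ + _)] at hpow
  generalize (∏ i ∈ Finset.range s, (q ^ s - q ^ i)) = x at *
  generalize (∏ i ∈ Finset.Icc 1 m, (q ^ (2 * i) - 1)) = y at *
  calc _ = x * y * ((∏ j ∈ Finset.range m, q ^ (s + j)) *
        ∏ j ∈ Finset.range (s + m), q ^ (j + 1)) := by ac_rfl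
    _ = _ := by rw [hpow]; ac_rfl

section Standard

variable {F : Type*} [Field F] {n : ℕ}

/-- The standard symplectic form as a bilinear map. -/
def stdBilin (n : ℕ) (F : Type*) [Field F] :
    (Fin n ⊕ Fin n → F) →ₗ[F] (Fin n ⊕ Fin n → F) →ₗ[F] F :=
  Matrix.toLinearMap₂' F (stdJ n F)

theorem stdBilin_apply (x y : Fin n ⊕ Fin n → F) : stdBilin n F x y = stdSymplForm x y :=
  Matrix.toLinearMap₂'_apply' _ _ _

theorem stdSymplForm_eq_sum (x y : Fin n ⊕ Fin n → F) :
    stdSymplForm x y = ∑ i, (x (Sum.inr i) * y (Sum.inl i) - x (Sum.inl i) * y (Sum.inr i)) := by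
  simp [stdSymplForm, stdJ, dotProduct, Matrix.mulVec, Matrix.one_apply, Finset.sum_add_distrib,
    sub_eq_add_neg, add_comm]

theorem stdBilin_isAlt : (stdBilin n F).IsAlt := fun x => by
  simp [stdBilin_apply, stdSymplForm_eq_sum, mul_comm]

theorem stdBilin_separatingLeft : (stdBilin n F).SeparatingLeft := fun x hx => by
  simp only [stdBilin_apply, stdSymplForm_eq_sum] at hx
  ext (i | i)
  · simpa [Pi.single_apply] using hx (Pi.single (Sum.inr i) 1)
  · simpa [Pi.single_apply] using hx (Pi.single (Sum.inl i) 1)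

theorem isSymplectic_iff {g : Matrix (Fin n ⊕ Fin n) (Fin n ⊕ Fin n) F} :
    IsSymplectic g ↔ ∀ a b, stdSymplForm (gᵀ a) (gᵀ b) = stdJ n F a b := by
  have hentry : ∀ a b, (gᵀ * stdJ n F * g) a b = stdSymplForm (gᵀ a) (gᵀ b) := fun a b => by
    rw [Matrix.mul_assoc]; rfl
  have hform : ∀ u v, stdSymplForm (g *ᵥ u) (g *ᵥ v) = u ⬝ᵥ (gᵀ * stdJ n F * g) *ᵥ v :=
    fun u v => by
      rw [stdSymplForm, ← Matrix.vecMul_transpose, ← Matrix.dotProduct_mulVec,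
        Matrix.mulVec_mulVec, Matrix.mulVec_mulVec, Matrix.mul_assoc]
  constructor
  · intro h a b
    have hab := h.2 (Pi.single a 1) (Pi.single b 1)
    rw [hform, stdSymplForm] at hab
    simpa [hentry] using hab
  · intro h
    have hJ : gᵀ * stdJ n F * g = stdJ n F := by
      ext a b
      rw [hentry, h]
    refine ⟨?_, fun u v => by rw [hform, hJ]; rfl⟩
    rw [Matrix.isUnit_iff_isUnit_det]
    exact SymplecticGroup.symplectic_det (SymplecticGroup.mem_iff'.mpr hJ)

theorem isSymplectic_mul_iff {g h : Matrix (Fin n ⊕ Fin n) (Fin n ⊕ Fin n) F}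
    (hh : IsSymplectic h) : IsSymplectic (g * h) ↔ IsSymplectic g := by
  obtain ⟨⟨u, rfl⟩, hform⟩ := hh
  refine and_congr (Units.isUnit_mul_units g u) ⟨fun H x y => ?_, fun H x y => ?_⟩
  · have hxy := H ((u⁻¹ : Units _).1 *ᵥ x) ((u⁻¹ : Units _).1 *ᵥ y)
    rw [← hform ((u⁻¹ : Units _).1 *ᵥ x)] at hxy
    simpa [Matrix.mulVec_mulVec, Matrix.mul_assoc] using hxy
  · rw [← Matrix.mulVec_mulVec, ← Matrix.mulVec_mulVec, H, hform]

theorem isSymplectic_iff_frames {g : Matrix (Fin n ⊕ Fin n) (Fin n ⊕ Fin n) F}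
    {S : Submodule F (Fin n ⊕ Fin n → F)} {s : ℕ} :
    (IsSymplectic g ∧ ∀ i : Fin n, (i : ℕ) < s → gᵀ (Sum.inl i) ∈ S) ↔
      IsIsotropicFrame (stdBilin n F) S s (fun i : Fin n => gᵀ (Sum.inl i)) ∧
        IsDualFrame (stdBilin n F) (fun i : Fin n => gᵀ (Sum.inl i))
          (fun i : Fin n => gᵀ (Sum.inr i)) := by
  constructor
  · rintro ⟨hg, hS⟩
    have hli : LinearIndependent F g.col := Matrix.linearIndependent_cols_iff_isUnit.mpr hg.1
    rw [isSymplectic_iff] at hg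
    refine ⟨⟨hli.comp _ Sum.inl_injective, fun i j => ?_, hS⟩, fun i j => ?_, fun i j => ?_⟩ <;>
      rw [stdBilin_apply, hg] <;> simp [stdJ, Matrix.one_apply, Fin.ext_iff]
    split_ifs <;> simp
  · rintro ⟨⟨-, hee, hS⟩, hef, hff⟩
    refine ⟨isSymplectic_iff.mpr ?_, hS⟩
    rintro (i | i) (j | j) <;> rw [← stdBilin_apply]
    · simpa [stdJ] using hee i j
    · rw [hef i j]
      simp only [stdJ, Matrix.fromBlocks_apply₁₂, Matrix.neg_apply, Matrix.one_apply, Fin.ext_iff]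
      split_ifs <;> simp
    · rw [← stdBilin_isAlt.neg, hef j i]
      simp only [stdJ, Matrix.fromBlocks_apply₂₁, Matrix.one_apply, Fin.ext_iff, eq_comm]
      split_ifs <;> simp
    · simpa [stdJ] using hff i j

theorem isSymplectic_and_map_eq_iff {g h : Matrix (Fin n ⊕ Fin n) (Fin n ⊕ Fin n) F}
    {S : Submodule F (Fin n ⊕ Fin n → F)} (hS : Module.finrank F S ≤ n) (hh : IsSymplectic h)
    (hhS : ∀ i : Fin n, (i : ℕ) < Module.finrank F S → hᵀ (Sum.inl i) ∈ S) :
    (IsSymplectic g ∧ S.map g.mulVecLin = S) ↔ IsSymplectic (g * h) ∧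
      ∀ i : Fin n, (i : ℕ) < Module.finrank F S → (g * h)ᵀ (Sum.inl i) ∈ S := by
  rw [isSymplectic_mul_iff hh]
  refine and_congr_right fun hg => ?_
  have hcol : ∀ a, (g * h)ᵀ a = g.mulVecLin (hᵀ a) := fun a => rfl
  simp only [hcol]
  constructor
  · intro hmap i hi
    rw [← hmap]
    exact Submodule.mem_map_of_mem (hhS i hi)
  · intro hgS
    have hli : LinearIndependent F h.col := Matrix.linearIndependent_cols_iff_isUnit.mpr hh.1
    have hli' : LinearIndependent F fun i : Fin (Module.finrank F S) =>
        hᵀ (Sum.inl (Fin.castLE hS i)) :=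
      hli.comp _ (Sum.inl_injective.comp (Fin.castLE_injective hS))
    have hspan : Submodule.span F (Set.range fun i : Fin (Module.finrank F S) =>
        hᵀ (Sum.inl (Fin.castLE hS i))) = S := by
      refine Submodule.eq_of_le_of_finrank_eq ?_ (by simpa using finrank_span_eq_card hli')
      rw [Submodule.span_le]
      rintro _ ⟨i, rfl⟩
      exact hhS _ i.2
    have hinj : Function.Injective g.mulVecLin := Matrix.mulVec_injective_iff_isUnit.mpr hg.1
    refine Submodule.eq_of_le_of_finrank_eq ?_ 
      (LinearEquiv.finrank_eq (Submodule.equivMapOfInjective _ hinj S)).symm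
    conv_lhs => rw [← hspan]
    rw [Submodule.map_span_le]
    rintro _ ⟨i, rfl⟩
    exact hgS _ i.2

variable [Fintype F]

theorem IsTotallyIsotropic.finrank_le {S : Submodule F (Fin n ⊕ Fin n → F)}
    (hS : IsTotallyIsotropic S) : Module.finrank F S ≤ n := by
  set b := Module.finBasis F S
  have hli : LinearIndependent F fun i => (b i : Fin n ⊕ Fin n → F) :=
    b.linearIndependent.map' S.subtype S.ker_subtype
  have hcard := card_pairing_eq stdBilin_separatingLeft hli 0
  have hle : Nat.card S ≤
      Nat.card {w | ∀ i, stdBilin n F (b i) w = (0 : Fin (Module.finrank F S) → F) i} :=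
    Nat.card_mono (Set.toFinite _) (s := (S : Set (Fin n ⊕ Fin n → F))) fun w hw i => by
      rw [stdBilin_apply]; exact hS _ (b i).2 _ hw
  rw [hcard, Module.natCard_eq_pow_finrank (K := F), Nat.card_eq_fintype_card,
    Nat.pow_le_pow_iff_right Fintype.one_lt_card, Module.finrank_fintype_fun_eq_card] at hle
  simp at hle
  omega

/-- The number of symplectic matrices whose first `dim S` columns lie in `S`. -/
theorem card_isSymplectic_frames {S : Submodule F (Fin n ⊕ Fin n → F)}
    (hS : IsTotallyIsotropic S) :
    Nat.card {g : Matrix (Fin n ⊕ Fin n) (Fin n ⊕ Fin n) F | IsSymplectic g ∧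
        ∀ i : Fin n, (i : ℕ) < Module.finrank F S → gᵀ (Sum.inl i) ∈ S} =
      (∏ i ∈ Finset.range n, if i < Module.finrank F S
        then Fintype.card F ^ Module.finrank F S - Fintype.card F ^ i
        else Fintype.card F ^ (2 * n - i) - Fintype.card F ^ i) *
      ∏ j ∈ Finset.range n, Fintype.card F ^ (2 * n - (n + j)) := by
  have hdim : Module.finrank F (Fin n ⊕ Fin n → F) = 2 * n := by
    simp [two_mul]
  have hiso := card_isIsotropicFrame stdBilin_separatingLeft stdBilin_isAlt
    (S := S) (fun u hu v hv => (stdBilin_apply u v).trans (hS u hu v hv)) n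
  rw [hdim] at hiso
  rw [← hiso]
  let E : (Fin n → Fin n ⊕ Fin n → F) × (Fin n → Fin n ⊕ Fin n → F) ≃
      Matrix (Fin n ⊕ Fin n) (Fin n ⊕ Fin n) F :=
    { toFun := fun p => (Matrix.of (Sum.elim p.1 p.2))ᵀ
      invFun := fun g => (fun i => gᵀ (Sum.inl i), fun i => gᵀ (Sum.inr i))
      left_inv := fun _ => rfl
      right_inv := fun g => by ext a (i | i) <;> rfl }
  refine card_eq_card_mul_of_prodEquiv E (Q := IsIsotropicFrame (stdBilin n F) S _)
    (R := IsDualFrame (stdBilin n F))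
    (fun e f => isSymplectic_iff_frames (g := E (e, f))) fun e he => ?_
  rw [← hdim]
  exact card_isDualFrame stdBilin_separatingLeft stdBilin_isAlt le_rfl he.1 he.2.1

end Standard

/-- Let `F` be a finite field with `q` elements and `S` a totally isotropic
subspace of `F^{2n}` of dimension `s`. The stabilizer `P(S)` of `S` in the symplectic group
has cardinality `q^{s(s+1)/2 + 2s(n-s)} · |GL_s(F)| · |Sp_{2(n-s)}(F)|`, i.e.
`q^{s(s+1)/2 + 2s(n-s)} · Π_{i=0}^{s-1}(q^s - q^i) · q^{(n-s)²} Π_{i=1}^{n-s}(q^{2i} - 1)`. -/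
theorem parabolic_stabilizer_card
    (F : Type*) [Field F] [Fintype F] (n s : ℕ)
    (S : Submodule F (Fin n ⊕ Fin n → F))
    (hS : IsTotallyIsotropic S) (hs : Module.finrank F S = s) :
    Nat.card {g : Matrix (Fin n ⊕ Fin n) (Fin n ⊕ Fin n) F |
        IsSymplectic g ∧ S.map g.mulVecLin = S} =
      Fintype.card F ^ (s * (s + 1) / 2 + 2 * s * (n - s)) *
        (∏ i ∈ Finset.range s, (Fintype.card F ^ s - Fintype.card F ^ i)) *
        (Fintype.card F ^ ((n - s) ^ 2) *
          ∏ i ∈ Finset.Icc 1 (n - s), (Fintype.card F ^ (2 * i) - 1)) := by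
  subst hs
  have hle := hS.finrank_le
  have hq : 1 < Fintype.card F := Fintype.one_lt_card
  have hcount := card_isSymplectic_frames hS
  have hpos : 0 < Nat.card {g : Matrix (Fin n ⊕ Fin n) (Fin n ⊕ Fin n) F | IsSymplectic g ∧
      ∀ i : Fin n, (i : ℕ) < Module.finrank F S → gᵀ (Sum.inl i) ∈ S} := by
    rw [hcount]
    refine Nat.mul_pos (Finset.prod_pos fun i hi => ?_)
      (Finset.prod_pos fun i _ => Nat.pow_pos (by omega))
    have := Finset.mem_range.mp hi
    split_ifs
    · exact Nat.sub_pos_of_lt (Nat.pow_lt_pow_right hq (by omega))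
    · exact Nat.sub_pos_of_lt (Nat.pow_lt_pow_right hq (by omega))
  obtain ⟨⟨h, hh, hhS⟩⟩ := (Nat.card_pos_iff.mp hpos).1
  obtain ⟨u, rfl⟩ := hh.1
  obtain ⟨m, hm⟩ := Nat.exists_eq_add_of_le hle
  refine (Nat.card_congr ((Units.mulRight u).subtypeEquiv fun g =>
    isSymplectic_and_map_eq_iff (g := g) hle hh hhS)).trans (hcount.trans ?_)
  have hsub : n - Module.finrank F S = m := by omega
  rw [hsub, ← symplectic_frame_count_eq, ← hm]
end

section
/- Let q be a prime power, let V = 𝔽_q^{2n} carry the standard symplectic form ⟨x, y⟩ = xᵀ J y with J = [[0, -1ₙ],[1ₙ, 0]], and let s be an integer with 0 ≤ s ≤ n. Then the number of totally isotropic subspaces of V of dimension s equals ( Π_{i=1}^{n} (q^i − 1) ) / ( ( Π_{i=1}^{s} (q^i − 1) ) · ( Π_{i=1}^{n−s} (q^i − 1) ) ) · Π_{j=n−s+1}^{n} (q^j + 1), i.e., the Gaussian binomial coefficient [n choose s]_q times Π_{j=n−s+1}^{n} (q^j + 1). -/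
open Matrix

namespace LinearMap.BilinForm

open Module Submodule

variable {F V : Type*} [Field F] [AddCommGroup V] [Module F V] {B : LinearMap.BilinForm F V}

theorem span_singleton_sup_le_orthogonal_iff (hB : B.IsAlt) (W : Submodule F V) (v : V) :
    (F ∙ v) ⊔ W ≤ B.orthogonal ((F ∙ v) ⊔ W) ↔
      W ≤ B.orthogonal W ∧ v ∈ B.orthogonal W := by
  constructor
  · intro h
    exact ⟨fun w hw u hu => h (mem_sup_right hw) u (mem_sup_right hu),
      fun u hu => h (mem_sup_left (mem_span_singleton_self v)) u (mem_sup_right hu)⟩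
  · rintro ⟨hW, hv⟩ x hx y hy
    obtain ⟨a, ha, w, hw, rfl⟩ := mem_sup.mp hx
    obtain ⟨b, hb, u, hu, rfl⟩ := mem_sup.mp hy
    obtain ⟨c, rfl⟩ := mem_span_singleton.mp ha
    obtain ⟨d, rfl⟩ := mem_span_singleton.mp hb
    have h₁ : B u v = 0 := hv u hu
    have h₂ : B v w = 0 := by rw [← hB.neg_eq, hv w hw, neg_zero]
    have h₃ : B u w = 0 := hW hw u hu
    have h₄ : B v v = 0 := hB v
    simp [h₁, h₂, h₃, h₄]

/-- A linearly independent family spanning a totally isotropic subspace. -/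
def IsIsotropicFrame (B : LinearMap.BilinForm F V) {k : ℕ} (f : Fin k → V) : Prop :=
  LinearIndependent F f ∧ span F (Set.range f) ≤ B.orthogonal (span F (Set.range f))

theorem isIsotropicFrame_cons_iff (hB : B.IsAlt) {k : ℕ} (v : V) (f : Fin k → V) :
    B.IsIsotropicFrame (Fin.cons v f : Fin (k + 1) → V) ↔
      B.IsIsotropicFrame f ∧
        v ∈ (B.orthogonal (span F (Set.range f)) : Set V) \ span F (Set.range f) := by
  rw [IsIsotropicFrame, IsIsotropicFrame, linearIndependent_finCons, Fin.range_cons, span_insert,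
    span_singleton_sup_le_orthogonal_iff hB, Set.mem_sdiff, SetLike.mem_coe, SetLike.mem_coe]
  tauto

/-- An isotropic frame is a shorter isotropic frame together with a vector orthogonal to, but not
contained in, its span. -/
def isotropicFrameSuccEquiv (hB : B.IsAlt) (k : ℕ) :
    {f : Fin (k + 1) → V // B.IsIsotropicFrame f} ≃
      Σ f : {f : Fin k → V // B.IsIsotropicFrame f},
        ((B.orthogonal (span F (Set.range f.1)) : Set V) \ span F (Set.range f.1) : Set V) where
  toFun f := ⟨⟨Fin.tail f.1, ((isIsotropicFrame_cons_iff hB (f.1 0) _).mp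
      (by rw [Fin.cons_self_tail]; exact f.2)).1⟩,
    ⟨f.1 0, ((isIsotropicFrame_cons_iff hB (f.1 0) _).mp
      (by rw [Fin.cons_self_tail]; exact f.2)).2⟩⟩
  invFun p := ⟨Fin.cons p.2.1 p.1.1, (isIsotropicFrame_cons_iff hB _ _).mpr ⟨p.1.2, p.2.2⟩⟩
  left_inv f := by simp
  right_inv := fun ⟨_, _⟩ => rfl

variable [Fintype F] [Finite V]

theorem card_isotropicFrame (hB : B.IsAlt) (hB' : B.Nondegenerate) (k : ℕ) :
    (Nat.card {f : Fin k → V // B.IsIsotropicFrame f}) =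
      ∏ i ∈ Finset.range k,
        (Fintype.card F ^ (finrank F V - i) - Fintype.card F ^ i) := by
  induction k with
  | zero =>
    have : Unique {f : Fin 0 → V // B.IsIsotropicFrame f} :=
      { default := ⟨Fin.elim0, linearIndependent_empty_type, by simp⟩
        uniq := fun _ => Subsingleton.elim _ _ }
    simp
  | succ k ih =>
    have := Fintype.ofFinite {f : Fin k → V // B.IsIsotropicFrame f}
    have key (f : {f : Fin k → V // B.IsIsotropicFrame f}) :
        Nat.card ((B.orthogonal (span F (Set.range f.1)) : Set V) \ span F (Set.range f.1) : Set V)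
          = Fintype.card F ^ (finrank F V - k) - Fintype.card F ^ k := by
      have hk : finrank F (span F (Set.range f.1)) = k := by
        rw [finrank_span_eq_card f.2.1, Fintype.card_fin]
      rw [Nat.card_coe_set_eq, Set.ncard_sdiff f.2.2, ← Nat.card_coe_set_eq, ← Nat.card_coe_set_eq,
        SetLike.coe_sort_coe, SetLike.coe_sort_coe,
        Module.natCard_eq_pow_finrank (K := F) (V := B.orthogonal _),
        Module.natCard_eq_pow_finrank (K := F) (V := span F _), finrank_orthogonal hB', hk,
        Nat.card_eq_fintype_card]
    rw [Nat.card_congr (isotropicFrameSuccEquiv hB k), Nat.card_sigma,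
      Finset.sum_congr rfl fun f _ => key f, Finset.sum_const, Finset.card_univ,
      ← Nat.card_eq_fintype_card, ih, Finset.prod_range_succ, smul_eq_mul]

/-- The isotropic frames spanning a given totally isotropic subspace of the right dimension are
its linearly independent families. -/
def isotropicFrameFiberEquiv {k : ℕ}
    (S : {S : Submodule F V // S ≤ B.orthogonal S ∧ finrank F S = k}) :
    {f : {f : Fin k → V // B.IsIsotropicFrame f} // span F (Set.range f.1) = S.1} ≃
      {g : Fin k → S.1 // LinearIndependent F g} where
  toFun f := ⟨fun i => ⟨f.1.1 i, f.2.le (subset_span (Set.mem_range_self i))⟩,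
    LinearIndependent.of_comp S.1.subtype f.1.2.1⟩
  invFun g :=
    have h : LinearIndependent F (S.1.subtype ∘ g.1) := g.2.map' _ S.1.ker_subtype
    have hs : span F (Set.range (S.1.subtype ∘ g.1)) = S.1 :=
      eq_of_le_of_finrank_eq (span_le.mpr (by rintro _ ⟨i, rfl⟩; exact (g.1 i).2))
        (by rw [finrank_span_eq_card h, Fintype.card_fin, S.2.2])
    ⟨⟨S.1.subtype ∘ g.1, h, by rw [hs]; exact S.2.1⟩, hs⟩
  left_inv _ := rfl
  right_inv _ := rfl

theorem card_isotropicFrame_eq_card_mul (B : LinearMap.BilinForm F V) (k : ℕ) :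
    Nat.card {f : Fin k → V // B.IsIsotropicFrame f} =
      Nat.card {S : Submodule F V // S ≤ B.orthogonal S ∧ finrank F S = k} *
        ∏ i ∈ Finset.range k, (Fintype.card F ^ k - Fintype.card F ^ i) := by
  let T := {S : Submodule F V // S ≤ B.orthogonal S ∧ finrank F S = k}
  have : Fintype T := Fintype.ofFinite T
  let φ : {f : Fin k → V // B.IsIsotropicFrame f} → T := fun f =>
    ⟨span F (Set.range f.1), f.2.2, by rw [finrank_span_eq_card f.2.1, Fintype.card_fin]⟩
  have key (S : T) : Nat.card {f // φ f = S} =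
      ∏ i ∈ Finset.range k, (Fintype.card F ^ k - Fintype.card F ^ i) := by
    rw [Nat.card_congr ((Equiv.subtypeEquivRight fun f => Subtype.ext_iff).trans
      (isotropicFrameFiberEquiv S)), card_linearIndependent S.2.2.ge, S.2.2,
      Finset.prod_range fun i => Fintype.card F ^ k - Fintype.card F ^ i]
  rw [← Nat.card_congr (Equiv.sigmaFiberEquiv φ), Nat.card_sigma,
    Finset.sum_congr rfl fun S _ => key S, Finset.sum_const, Finset.card_univ,
    ← Nat.card_eq_fintype_card, smul_eq_mul]

end LinearMap.BilinForm

theorem stdSymplForm_eq_toBilin' {n : ℕ} {F : Type*} [Field F] (x y : Fin n ⊕ Fin n → F) :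
    stdSymplForm x y = Matrix.toBilin' (stdJ n F) x y :=
  (Matrix.toBilin'_apply' _ _ _).symm

theorem isAlt_toBilin'_stdJ (n : ℕ) (F : Type*) [Field F] :
    (Matrix.toBilin' (stdJ n F)).IsAlt := by
  intro x
  rw [Matrix.toBilin'_apply', stdJ, Matrix.fromBlocks_mulVec, ← Sum.elim_comp_inl_inr x,
    sumElim_dotProduct_sumElim]
  simp [Matrix.neg_mulVec, dotProduct_comm]

theorem nondegenerate_toBilin'_stdJ (n : ℕ) (F : Type*) [Field F] :
    (Matrix.toBilin' (stdJ n F)).Nondegenerate :=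
  LinearMap.BilinForm.nondegenerate_toBilin'_of_det_ne_zero' _
    (Matrix.isUnit_det_J (Fin n) F).ne_zero

theorem isTotallyIsotropic_iff_le_orthogonal {n : ℕ} {F : Type*} [Field F]
    (S : Submodule F (Fin n ⊕ Fin n → F)) :
    IsTotallyIsotropic S ↔ S ≤ (Matrix.toBilin' (stdJ n F)).orthogonal S := by
  simp only [IsTotallyIsotropic, stdSymplForm_eq_toBilin']
  exact ⟨fun h x hx y hy => h y hy x hx, fun h u hu v hv => h hv u hu⟩

theorem prod_Icc_one_add {M : Type*} [CommMonoid M] (g : ℕ → M) (m s : ℕ) :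
    ∏ i ∈ Finset.Icc 1 (m + s), g i =
      (∏ i ∈ Finset.Icc 1 m, g i) * ∏ i ∈ Finset.Icc (m + 1) (m + s), g i := by
  induction s with
  | zero => simp
  | succ s ih =>
    rw [← add_assoc, Finset.prod_Icc_succ_top (by lia), Finset.prod_Icc_succ_top (by lia), ih,
      mul_assoc]

theorem prod_Icc_eq_prod_range_sub {M : Type*} [CommMonoid M] (g : ℕ → M) (m s : ℕ) :
    ∏ i ∈ Finset.Icc (m + 1) (m + s), g i = ∏ i ∈ Finset.range s, g (m + s - i) := by
  induction s with
  | zero => simp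
  | succ s ih =>
    rw [← add_assoc, Finset.prod_Icc_succ_top (by lia), ih, Finset.prod_range_succ']
    congr 1
    exact Finset.prod_congr rfl fun i _ => by congr 1; lia

/-- Let `F` be a finite field with `q` elements and `0 ≤ s ≤ n`. The number
of totally isotropic subspaces of `F^{2n}` of dimension `s` equals the Gaussian binomial
coefficient `[n choose s]_q = Π_{i=1}^n (q^i-1) / (Π_{i=1}^s (q^i-1) · Π_{i=1}^{n-s} (q^i-1))`
times `Π_{j=n-s+1}^n (q^j + 1)`. -/
theorem card_isotropic_grassmannian
    (F : Type*) [Field F] [Fintype F] (n s : ℕ) (hsn : s ≤ n) :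
    (Nat.card {S : Submodule F (Fin n ⊕ Fin n → F) |
        IsTotallyIsotropic S ∧ Module.finrank F S = s} : ℚ) =
      (∏ i ∈ Finset.Icc 1 n, ((Fintype.card F : ℚ) ^ i - 1)) /
        ((∏ i ∈ Finset.Icc 1 s, ((Fintype.card F : ℚ) ^ i - 1)) *
          (∏ i ∈ Finset.Icc 1 (n - s), ((Fintype.card F : ℚ) ^ i - 1))) *
        ∏ j ∈ Finset.Icc (n - s + 1) n, ((Fintype.card F : ℚ) ^ j + 1) := by
  set q := Fintype.card F with hq
  have hq1 : 1 < q := Fintype.one_lt_card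
  obtain ⟨m, rfl⟩ := Nat.exists_eq_add_of_le' hsn
  have hcard : Nat.card {S : Submodule F (Fin (m + s) ⊕ Fin (m + s) → F) |
        IsTotallyIsotropic S ∧ Module.finrank F S = s} =
      Nat.card {S : Submodule F (Fin (m + s) ⊕ Fin (m + s) → F) //
        S ≤ (Matrix.toBilin' (stdJ (m + s) F)).orthogonal S ∧ Module.finrank F S = s} :=
    Nat.card_congr (Equiv.subtypeEquivRight fun S =>
      and_congr_left fun _ => isTotallyIsotropic_iff_le_orthogonal S)
  have hcount := (LinearMap.BilinForm.card_isotropicFrame_eq_card_mul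
    (Matrix.toBilin' (stdJ (m + s) F)) s).symm.trans
    (LinearMap.BilinForm.card_isotropicFrame (isAlt_toBilin'_stdJ (m + s) F)
      (nondegenerate_toBilin'_stdJ (m + s) F) s)
  rw [← hcard, ← hq, Module.finrank_fintype_fun_eq_card, Fintype.card_sum, Fintype.card_fin]
    at hcount
  have hl : ∏ i ∈ Finset.range s, ((q ^ s - q ^ i : ℕ) : ℚ) =
      (∏ i ∈ Finset.range s, (q : ℚ) ^ i) * ∏ i ∈ Finset.Icc 1 s, ((q : ℚ) ^ i - 1) := by
    have h := prod_Icc_eq_prod_range_sub (fun i => (q : ℚ) ^ i - 1) 0 s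
    simp only [zero_add] at h
    rw [h, ← Finset.prod_mul_distrib]
    refine Finset.prod_congr rfl fun i hi => ?_
    have hi' := Finset.mem_range.mp hi
    rw [Nat.cast_sub (Nat.pow_le_pow_right hq1.le hi'.le), mul_sub, ← pow_add,
      Nat.add_sub_of_le hi'.le]
    push_cast
    ring
  have hr : ∏ i ∈ Finset.range s, ((q ^ (m + s + (m + s) - i) - q ^ i : ℕ) : ℚ) =
      (∏ i ∈ Finset.range s, (q : ℚ) ^ i) *
        ((∏ i ∈ Finset.Icc (m + 1) (m + s), ((q : ℚ) ^ i - 1)) *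
          ∏ i ∈ Finset.Icc (m + 1) (m + s), ((q : ℚ) ^ i + 1)) := by
    rw [prod_Icc_eq_prod_range_sub, prod_Icc_eq_prod_range_sub, ← Finset.prod_mul_distrib,
      ← Finset.prod_mul_distrib]
    refine Finset.prod_congr rfl fun i hi => ?_
    have hi' := Finset.mem_range.mp hi
    rw [Nat.cast_sub (Nat.pow_le_pow_right hq1.le (by lia)),
      show m + s + (m + s) - i = i + ((m + s - i) + (m + s - i)) by lia]
    push_cast
    ring
  have hpos (i : ℕ) (hi : 1 ≤ i) : (q : ℚ) ^ i - 1 ≠ 0 :=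
    (sub_pos.mpr (one_lt_pow₀ (by exact_mod_cast hq1) (by lia))).ne'
  have hne (k : ℕ) : ∏ i ∈ Finset.Icc 1 k, ((q : ℚ) ^ i - 1) ≠ 0 :=
    Finset.prod_ne_zero_iff.mpr fun i hi => hpos i (Finset.mem_Icc.mp hi).1
  have hq0 : ∏ i ∈ Finset.range s, (q : ℚ) ^ i ≠ 0 :=
    Finset.prod_ne_zero_iff.mpr fun i _ => pow_ne_zero i (by exact_mod_cast (by lia : q ≠ 0))
  have hcount' := congrArg (Nat.cast : ℕ → ℚ) hcount
  rw [Nat.cast_mul, Nat.cast_prod, Nat.cast_prod, hl, hr, mul_left_comm] at hcount'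
  have hmain := mul_left_cancel₀ hq0 hcount'
  rw [Nat.add_sub_cancel, prod_Icc_one_add, div_mul_eq_mul_div,
    eq_div_iff (mul_ne_zero (hne s) (hne m)), ← mul_assoc, hmain]
  ring
end

section
/- Let π : {1, …, k} → {1, …, m} be an increasing surjection, let P = (p₁, …, p_k) be a probability vector with all p_i > 0, let Q = π_*P be its push-forward with entries q_j = Σ_{i ∈ π⁻¹(j)} p_i, and for each j let P|_j be the conditional probability vector on π⁻¹(j) with entries p_i/q_j. Then the symplectic entropy satisfies the chain rule H_Sp(P) = H_Sp(Q) + Σ_{j=1}^{m-1} (q_j²/2) · H₂(P|_j) + q_m² · H_Sp(P|_m). -/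
open Finset

/-- Chain rule for the symplectic entropy
`H_Sp(P) = ½·H₂(P) + ½·(1 - p_last²)`, where `H₂(P) = 1 - Σᵢ pᵢ²` is the Tsallis 2-entropy.
For an increasing surjection `π : {1,…,k+1} → {1,…,m+1}`, a positive probability vector `P`
with push-forward `Q = π_*P` (`q j = Σ_{i ∈ π⁻¹(j)} p i`) and conditional vectors `P|_j`
with entries `pᵢ/q_j`, one has
`H_Sp(P) = H_Sp(Q) + Σ_{j=1}^{m} (q_j²/2)·H₂(P|_j) + q_{m+1}²·H_Sp(P|_{m+1})`. -/
theorem symplectic_entropy_chain_rule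
    (k m : ℕ) (π : Fin (k + 1) → Fin (m + 1)) (hmono : Monotone π)
    (hsurj : Function.Surjective π)
    (p : Fin (k + 1) → ℝ) (hp0 : ∀ i, 0 < p i) (hp1 : ∑ i, p i = 1) :
    ∀ q : Fin (m + 1) → ℝ, (∀ j, q j = ∑ i ∈ univ.filter (fun i => π i = j), p i) →
      ((1 / 2) * (1 - ∑ i, p i ^ 2) + (1 / 2) * (1 - p (Fin.last k) ^ 2)) =
        (((1 / 2) * (1 - ∑ j, q j ^ 2) + (1 / 2) * (1 - q (Fin.last m) ^ 2)) +
          (∑ j : Fin m, (q j.castSucc ^ 2 / 2) *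
            (1 - ∑ i ∈ univ.filter (fun i => π i = j.castSucc),
              (p i / q j.castSucc) ^ 2)) +
          q (Fin.last m) ^ 2 *
            ((1 / 2) * (1 - ∑ i ∈ univ.filter (fun i => π i = Fin.last m),
                (p i / q (Fin.last m)) ^ 2) +
              (1 / 2) * (1 - (p (Fin.last k) / q (Fin.last m)) ^ 2))) := by
  intro q hq
  have hq0 : ∀ j, q j ≠ 0 := by
    intro j
    obtain ⟨i, hi⟩ := hsurj j
    rw [hq j]
    exact (sum_pos (fun i _ => hp0 i) ⟨i, by simp [hi]⟩).ne'
  have hcond : ∀ j, ∑ i ∈ univ.filter (fun i => π i = j), (p i / q j) ^ 2 =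
      (∑ i ∈ univ.filter (fun i => π i = j), p i ^ 2) / q j ^ 2 := by
    intro j
    simp only [div_pow, sum_div]
  have hfiber : ∑ i, p i ^ 2 = ∑ j, ∑ i ∈ univ.filter (fun i => π i = j), p i ^ 2 :=
    (sum_fiberwise univ π fun i => p i ^ 2).symm
  have hterm : ∀ j (s : ℝ), q j ^ 2 / 2 * (1 - s / q j ^ 2) = q j ^ 2 / 2 - s / 2 := by
    intro j s
    have := hq0 j
    field_simp
  simp only [hcond, hterm]
  rw [hfiber, Fin.sum_univ_castSucc, Fin.sum_univ_castSucc (fun j => q j ^ 2),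
    sum_sub_distrib, ← sum_div, ← sum_div]
  have := hq0 (Fin.last m)
  field_simp
  ring
end
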